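/- arXiv:2303.14085 — 6 statements merged into one kernel-verified Lean document; each statement's English description precedes it below -/
import Mathlib

section
/- Let G be a sorted DAG with vertex set {1,…,n} and parent sets pa_i, and let X = X_1×…×X_n be a product of nonempty Polish spaces. For a Borel probability measure μ on X, the following are equivalent: (ii) for every random variable X ~ μ one has X_i ⫫_{X_{pa_i}} X_{1:i-1} for all i = 2,…,n; (iii) μ disintegrates as μ(dx_1,…,dx_n) = ⨂_{i=1}^n μ(dx_i | x_{pa_i}), i.e. the successive conditional distributions μ(dx_i | x_1,…,x_{i-1}) agree μ-almost surely with versions depending only on x_{pa_i}. -/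
open MeasureTheory ProbabilityTheory
open scoped ENNReal

/-- The indicator of the event `{S ∈ A}`, as a real-valued random variable. -/
noncomputable def evtInd {Ω α : Type*} (S : Ω → α) (A : Set α) : Ω → ℝ :=
  (S ⁻¹' A).indicator fun _ => (1 : ℝ)

/-- Conditional independence `S ⫫_Z W` of `S` and `W` given (the σ-algebra generated by) `Z`
under `P`: for all measurable sets `A`, `B`,
`P[1_{S ∈ A} 1_{W ∈ B} | σ(Z)] = P[1_{S ∈ A} | σ(Z)] ⬝ P[1_{W ∈ B} | σ(Z)]` `P`-a.s. -/
def CondIndepRV {Ω α β γ : Type*} [MeasurableSpace Ω] [MeasurableSpace α]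
    [MeasurableSpace β] [MeasurableSpace γ]
    (P : Measure Ω) (S : Ω → α) (W : Ω → β) (Z : Ω → γ) : Prop :=
  ∀ (A : Set α) (B : Set β), MeasurableSet A → MeasurableSet B →
    (P[evtInd S A * evtInd W B | MeasurableSpace.comap Z inferInstance])
      =ᵐ[P]
    (P[evtInd S A | MeasurableSpace.comap Z inferInstance]) *
      (P[evtInd W B | MeasurableSpace.comap Z inferInstance])

/-- A probability measure `μ` on a product space is compatible with the (sorted) DAG with
edge relation `E` (`μ ∈ P_G(X)`) if for every random variable `X ~ μ`, `X i` is conditionally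
independent of `X_{1:i-1}` given the parents `X_{pa i}`, for all `i = 2, …, n`. -/
def IsGComp {n : ℕ} (E : Fin n → Fin n → Prop) (𝒳 : Fin n → Type)
    [∀ i, MeasurableSpace (𝒳 i)] (μ : Measure (∀ i, 𝒳 i)) : Prop :=
  ∀ (Ω : Type) (_ : MeasurableSpace Ω) (P : Measure Ω), IsProbabilityMeasure P →
    ∀ X : Ω → ∀ i, 𝒳 i, Measurable X → P.map X = μ →
      ∀ i : Fin n, 0 < (i : ℕ) →
        CondIndepRV P (fun ω => X ω i)
          (fun ω (j : {k : Fin n // (k : ℕ) < (i : ℕ)}) => X ω j.1)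
          (fun ω (j : {k : Fin n // E k i}) => X ω j.1)

lemma stronglyMeasurable_comap_kernel_real {Ω 𝒴 𝒵 : Type*} [MeasurableSpace 𝒴]
    [MeasurableSpace 𝒵] (κ : Kernel 𝒵 𝒴) (Z : Ω → 𝒵) {A : Set 𝒴}
    (hA : MeasurableSet A) :
    StronglyMeasurable[MeasurableSpace.comap Z inferInstance] fun ω => (κ (Z ω)).real A :=
  ((κ.measurable_coe hA).ennreal_toReal.comp
    (Measurable.of_comap_le le_rfl)).stronglyMeasurable

section CondIndep

variable {Ω 𝒴 𝒲 𝒵 : Type*} [MeasurableSpace Ω] [MeasurableSpace 𝒲] [MeasurableSpace 𝒵]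
  {P : Measure Ω} {W : Ω → 𝒲}

lemma integrable_evtInd [IsFiniteMeasure P] (hW : Measurable W) {B : Set 𝒲}
    (hB : MeasurableSet B) : Integrable (evtInd W B) P :=
  (integrable_const _).indicator (hW hB)

lemma integrable_mul_evtInd {g : Ω → ℝ} (hg : Integrable g P) (hW : Measurable W) {B : Set 𝒲}
    (hB : MeasurableSet B) : Integrable (g * evtInd W B) P := by
  have : g * evtInd W B = (W ⁻¹' B).indicator g := by
    ext ω
    by_cases h : ω ∈ W ⁻¹' B <;> simp [evtInd, h]
  exact this ▸ hg.indicator (hW hB)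

variable [IsProbabilityMeasure P] [MeasurableSpace 𝒴] {Y : Ω → 𝒴} {f : 𝒲 → 𝒵}

lemma integrable_kernel_real (κ : Kernel 𝒵 𝒴) [IsMarkovKernel κ] {Z : Ω → 𝒵} (hZ : Measurable Z)
    {A : Set 𝒴} (hA : MeasurableSet A) : Integrable (fun ω => (κ (Z ω)).real A) P := by
  refine Integrable.of_bound
    ((stronglyMeasurable_comap_kernel_real κ Z hA).mono hZ.comap_le).aestronglyMeasurable 1
    (.of_forall fun ω => ?_)
  rw [Real.norm_of_nonneg measureReal_nonneg]
  exact measureReal_le_one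

variable [StandardBorelSpace 𝒴] [Nonempty 𝒴]

/-- If `Y` and `W` are conditionally independent given `f ∘ W`, then the conditional distribution
of `Y` given `W` only depends on `f ∘ W`. -/
lemma CondIndepRV.condDistrib_ae_eq (hY : Measurable Y) (hW : Measurable W) (hf : Measurable f)
    (h : CondIndepRV P Y W (f ∘ W)) :
    condDistrib Y W P =ᵐ[P.map W] (condDistrib Y (f ∘ W) P).comap f hf := by
  have hZ : Measurable (f ∘ W) := hf.comp hW
  refine condDistrib_ae_eq_of_measure_eq_compProd W hY.aemeasurable ?_
  refine Measure.ext_prod fun {B A} hB hA => ?_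
  rw [Measure.compProd_apply_prod hB hA, setLIntegral_map hB (Kernel.measurable_coe _ hA) hW,
    Measure.map_apply (hW.prodMk hY) (hB.prod hA)]
  set g : Ω → ℝ := fun ω => (condDistrib Y (f ∘ W) P ((f ∘ W) ω)).real A with hg
  have hgint : Integrable g P := integrable_kernel_real _ hZ hA
  have hprod : ∫ ω, (g * evtInd W B) ω ∂P = ∫ ω, (evtInd Y A * evtInd W B) ω ∂P := by
    rw [← integral_condExp hZ.comap_le (f := g * evtInd W B),
      ← integral_condExp hZ.comap_le (f := evtInd Y A * evtInd W B)]
    refine integral_congr_ae ?_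
    have hpull := condExp_mul_of_stronglyMeasurable_left (μ := P)
      (stronglyMeasurable_comap_kernel_real (condDistrib Y (f ∘ W) P) (f ∘ W) hA)
      (integrable_mul_evtInd hgint hW hB) (integrable_evtInd hW hB)
    filter_upwards [hpull, h A B hA hB, condDistrib_ae_eq_condExp hZ hY hA (μ := P)]
      with ω h1 h2 h3
    rw [h1, h2, Pi.mul_apply, Pi.mul_apply, h3]
    rfl
  have hleft : ∫ ω, (g * evtInd W B) ω ∂P = ∫ ω in W ⁻¹' B, g ω ∂P := by
    rw [← integral_indicator (hW hB)]
    congr with ω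
    by_cases hω : ω ∈ W ⁻¹' B <;> simp [evtInd, hω]
  have hright : ∫ ω, (evtInd Y A * evtInd W B) ω ∂P = P.real (W ⁻¹' B ∩ Y ⁻¹' A) := by
    rw [← integral_indicator_one ((hW hB).inter (hY hA))]
    congr with ω
    by_cases h1 : ω ∈ W ⁻¹' B <;> by_cases h2 : ω ∈ Y ⁻¹' A <;> simp_all [evtInd]
  calc P ((fun a => (W a, Y a)) ⁻¹' B ×ˢ A) = ENNReal.ofReal (P.real (W ⁻¹' B ∩ Y ⁻¹' A)) := by
        rw [ofReal_measureReal]; rfl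
    _ = ENNReal.ofReal (∫ ω in W ⁻¹' B, g ω ∂P) := by rw [← hright, ← hprod, hleft]
    _ = ∫⁻ ω in W ⁻¹' B, ENNReal.ofReal (g ω) ∂P :=
        ofReal_integral_eq_lintegral_ofReal hgint.integrableOn
          (.of_forall fun _ => measureReal_nonneg)
    _ = _ := by simp [hg]

/-- If the conditional distribution of `Y` given `W` is a Markov kernel applied to `f ∘ W`, then
`Y` and `W` are conditionally independent given `f ∘ W`. -/
lemma condIndepRV_of_condDistrib_ae_eq (hY : Measurable Y) (hW : Measurable W)
    (hf : Measurable f) (κ : Kernel 𝒵 𝒴) [IsMarkovKernel κ]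
    (h : ∀ᵐ ω ∂P, condDistrib Y W P (W ω) = κ (f (W ω))) :
    CondIndepRV P Y W (f ∘ W) := by
  intro A B hA hB
  have hZ : Measurable (f ∘ W) := hf.comp hW
  have hZW : MeasurableSpace.comap (f ∘ W) inferInstance
      ≤ MeasurableSpace.comap W inferInstance := by
    rw [← MeasurableSpace.comap_comp]
    exact MeasurableSpace.comap_mono hf.comap_le
  set g : Ω → ℝ := fun ω => (κ ((f ∘ W) ω)).real A with hg
  have hgm := stronglyMeasurable_comap_kernel_real κ (f ∘ W) hA
  have hgint : Integrable g P := integrable_kernel_real κ hZ hA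
  have hYW : P[evtInd Y A | MeasurableSpace.comap W inferInstance] =ᵐ[P] g := by
    filter_upwards [h, condDistrib_ae_eq_condExp hW hY hA (μ := P)] with ω h1 h2
    rw [evtInd, ← h2, h1]
    rfl
  have hYZ : P[evtInd Y A | MeasurableSpace.comap (f ∘ W) inferInstance] =ᵐ[P] g :=
    calc P[evtInd Y A | MeasurableSpace.comap (f ∘ W) inferInstance]
      _ =ᵐ[P] P[P[evtInd Y A | MeasurableSpace.comap W inferInstance] |
            MeasurableSpace.comap (f ∘ W) inferInstance] :=
          (condExp_condExp_of_le hZW hW.comap_le).symm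
      _ =ᵐ[P] P[g | MeasurableSpace.comap (f ∘ W) inferInstance] := condExp_congr_ae hYW
      _ = g := condExp_of_stronglyMeasurable hZ.comap_le hgm hgint
  have hBm : StronglyMeasurable[MeasurableSpace.comap W inferInstance] (evtInd W B) :=
    stronglyMeasurable_const.indicator ⟨B, hB, rfl⟩
  have hYint : Integrable (evtInd Y A) P := integrable_evtInd hY hA
  have hpullW := condExp_mul_of_stronglyMeasurable_right hBm
    (integrable_mul_evtInd hYint hW hB) hYint
  calc P[evtInd Y A * evtInd W B | MeasurableSpace.comap (f ∘ W) inferInstance]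
    _ =ᵐ[P] P[P[evtInd Y A * evtInd W B | MeasurableSpace.comap W inferInstance] |
          MeasurableSpace.comap (f ∘ W) inferInstance] :=
        (condExp_condExp_of_le hZW hW.comap_le).symm
    _ =ᵐ[P] P[g * evtInd W B | MeasurableSpace.comap (f ∘ W) inferInstance] :=
        condExp_congr_ae (hpullW.trans (hYW.mul .rfl))
    _ =ᵐ[P] g * P[evtInd W B | MeasurableSpace.comap (f ∘ W) inferInstance] :=
        condExp_mul_of_stronglyMeasurable_left hgm (integrable_mul_evtInd hgint hW hB)
          (integrable_evtInd hW hB)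
    _ =ᵐ[P] _ := hYZ.symm.mul .rfl

end CondIndep

lemma condDistrib_map_eq_comp {Ω Ω' 𝒴 𝒲 : Type*} [MeasurableSpace Ω] [MeasurableSpace Ω']
    [MeasurableSpace 𝒴] [StandardBorelSpace 𝒴] [Nonempty 𝒴] [MeasurableSpace 𝒲]
    (P : Measure Ω) [IsFiniteMeasure P] {X : Ω → Ω'} {Y : Ω' → 𝒴} {W : Ω' → 𝒲}
    (hX : Measurable X) (hY : Measurable Y) (hW : Measurable W) :
    condDistrib Y W (P.map X) = condDistrib (Y ∘ X) (W ∘ X) P := by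
  rw [condDistrib, condDistrib]
  congr 1
  exact Measure.map_map (hW.prodMk hY) hX

/-- For a sorted DAG `G` and a Borel probability measure `μ` on a product
of nonempty Polish spaces, the conditional-independence characterization (ii) of
`G`-compatibility is equivalent to the disintegration characterization (iii): the successive
conditional distributions `μ(dx_i | x_1, …, x_(i-1))` agree `μ`-a.s. with (Markov-kernel)
versions depending only on `x_(pa i)`. -/
theorem gcomp_condIndep_iff_disintegration {n : ℕ} (E : Fin n → Fin n → Prop)
    (hE : ∀ i j, E i j → i < j) (𝒳 : Fin n → Type)
    [∀ i, TopologicalSpace (𝒳 i)] [∀ i, PolishSpace (𝒳 i)]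
    [∀ i, MeasurableSpace (𝒳 i)] [∀ i, BorelSpace (𝒳 i)] [∀ i, Nonempty (𝒳 i)]
    (μ : Measure (∀ i, 𝒳 i)) [IsProbabilityMeasure μ] :
    IsGComp E 𝒳 μ ↔
    (∀ i : Fin n,
      ∃ κ : Kernel (∀ j : {k : Fin n // E k i}, 𝒳 j.1) (𝒳 i), IsMarkovKernel κ ∧
        ∀ᵐ x ∂μ,
          condDistrib (fun y : ∀ l, 𝒳 l => y i)
            (fun y (j : {k : Fin n // (k : ℕ) < (i : ℕ)}) => y j.1) μ
            (fun j : {k : Fin n // (k : ℕ) < (i : ℕ)} => x j.1)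
          = κ (fun j : {k : Fin n // E k i} => x j.1)) := by
  have hpa (i : Fin n) : Measurable fun (w : ∀ j : {k : Fin n // (k : ℕ) < (i : ℕ)}, 𝒳 j.1)
      (j : {k : Fin n // E k i}) => w ⟨j.1, hE _ _ j.2⟩ := by fun_prop
  have hpast (i : Fin n) : Measurable fun (y : ∀ l, 𝒳 l)
      (j : {k : Fin n // (k : ℕ) < (i : ℕ)}) => y j.1 := by fun_prop
  constructor
  · intro h i
    rcases Nat.eq_zero_or_pos (i : ℕ) with hi | hi
    · have : IsEmpty {k : Fin n // (k : ℕ) < (i : ℕ)} := ⟨fun k => by have := k.2; omega⟩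
      refine ⟨(condDistrib (fun y : ∀ l, 𝒳 l => y i)
        (fun y (j : {k : Fin n // (k : ℕ) < (i : ℕ)}) => y j.1) μ).comap
          (fun _ => isEmptyElim) measurable_const, inferInstance, .of_forall fun x => ?_⟩
      rw [Kernel.comap_apply]
      exact congrArg _ (Subsingleton.elim _ _)
    · have hci := h _ _ μ inferInstance id measurable_id Measure.map_id i hi
      exact ⟨_, inferInstance, ae_of_ae_map (hpast i).aemeasurable
        (CondIndepRV.condDistrib_ae_eq (measurable_pi_apply i) (hpast i) (hpa i) hci)⟩
  · intro h Ω _ P _ X hX hμ i _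
    subst hμ
    obtain ⟨κ, hκ, hae⟩ := h i
    refine condIndepRV_of_condDistrib_ae_eq ((measurable_pi_apply i).comp hX)
      ((hpast i).comp hX) (hpa i) κ ?_
    rw [← condDistrib_map_eq_comp P hX (measurable_pi_apply i) (hpast i)]
    exact ae_of_ae_map hX.aemeasurable hae
end

section
/- Let G be a sorted DAG on {1,…,n} and X = X_1×…×X_n a product of nonempty Polish spaces. Then the set P_G(X) of G-compatible Borel probability measures on X is closed under convergence in total variation: if μ^k ∈ P_G(X) and μ^k → μ in total variation, then μ ∈ P_G(X). -/
open MeasureTheory ProbabilityTheory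
open scoped ENNReal

/-- Total variation distance between two measures. -/
noncomputable def tvDist {X : Type*} [MeasurableSpace X] (μ ν : Measure X) : ℝ≥0∞ :=
  ⨆ (A : Set X) (_ : MeasurableSet A), max (μ A - ν A) (ν A - μ A)

section TotalVariation

variable {Y : Type*} {m m₀ : MeasurableSpace Y} {μ ν : Measure Y} {d : ℝ}

/-- The total variation distance controls the difference of the measures of an event. -/
theorem abs_measureReal_sub_le_toReal_tvDist [IsProbabilityMeasure μ] [IsProbabilityMeasure ν]
    {A : Set Y} (hA : MeasurableSet A) :
    |μ.real A - ν.real A| ≤ (tvDist μ ν).toReal := by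
  have hfin : tvDist μ ν ≠ ∞ := by
    refine ne_top_of_le_ne_top ENNReal.one_ne_top (iSup₂_le fun B _ => max_le ?_ ?_) <;>
      exact tsub_le_self.trans prob_le_one
  have h : max (μ A - ν A) (ν A - μ A) ≤ tvDist μ ν :=
    le_iSup₂ (f := fun (A : Set Y) (_ : MeasurableSet A) => max (μ A - ν A) (ν A - μ A)) A hA
  have h₁ := (ENNReal.le_toReal_sub (measure_ne_top ν A)).trans
    (ENNReal.toReal_mono hfin ((le_max_left _ _).trans h))
  have h₂ := (ENNReal.le_toReal_sub (measure_ne_top μ A)).trans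
    (ENNReal.toReal_mono hfin ((le_max_right _ _).trans h))
  simp only [measureReal_def]
  exact abs_le.2 ⟨by linarith, h₁⟩

theorem integrable_of_mem_Icc_zero_one [IsFiniteMeasure μ] {f : Y → ℝ} (hf : Measurable f)
    (hf01 : ∀ y, f y ∈ Set.Icc 0 1) : Integrable f μ :=
  Integrable.of_mem_Icc 0 1 hf.aemeasurable (.of_forall hf01)

/-- Setwise closeness of two measures passes to integrals of `[0, 1]`-valued functions. -/
theorem abs_integral_sub_integral_le [IsFiniteMeasure μ] [IsFiniteMeasure ν]
    (hd : ∀ A, MeasurableSet A → |μ.real A - ν.real A| ≤ d) {f : Y → ℝ} (hf : Measurable f)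
    (hf01 : ∀ y, f y ∈ Set.Icc 0 1) : |∫ y, f y ∂μ - ∫ y, f y ∂ν| ≤ d := by
  have hint (ρ : Measure Y) [IsFiniteMeasure ρ] :
      IntegrableOn (fun t => ρ.real {y | t ≤ f y}) (Set.Ioc 0 1) := by
    have : Antitone fun t => ρ.real {y | t ≤ f y} := fun s t hst =>
      measureReal_mono fun y (hy : t ≤ f y) => hst.trans hy
    exact ((this.antitoneOn _).integrableOn_isCompact isCompact_Icc).mono_set
      Set.Ioc_subset_Icc_self
  have hcake (ρ : Measure Y) [IsFiniteMeasure ρ] :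
      ∫ y, f y ∂ρ = ∫ t in Set.Ioc 0 1, ρ.real {y | t ≤ f y} :=
    (integrable_of_mem_Icc_zero_one hf hf01).integral_eq_integral_Ioc_meas_le
      (.of_forall fun y => (hf01 y).1) (.of_forall fun y => (hf01 y).2)
  rw [hcake μ, hcake ν, ← integral_sub (hint μ) (hint ν)]
  simpa using norm_setIntegral_le_of_norm_le_const (μ := volume) (s := Set.Ioc (0 : ℝ) 1)
    (f := fun t => μ.real {y | t ≤ f y} - ν.real {y | t ≤ f y}) (C := d) (by simp)
    fun t _ => hd _ (measurableSet_le measurable_const hf)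

theorem abs_setIntegral_sub_setIntegral_le [IsFiniteMeasure μ] [IsFiniteMeasure ν]
    (hd : ∀ A, MeasurableSet A → |μ.real A - ν.real A| ≤ d) {f : Y → ℝ} (hf : Measurable f)
    (hf01 : ∀ y, f y ∈ Set.Icc 0 1) {D : Set Y} (hD : MeasurableSet D) :
    |∫ y in D, f y ∂μ - ∫ y in D, f y ∂ν| ≤ d := by
  rw [← integral_indicator hD, ← integral_indicator hD]
  refine abs_integral_sub_integral_le hd (hf.indicator hD) fun y => ?_
  by_cases hy : y ∈ D <;> simp [hy, (hf01 y).1, (hf01 y).2]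

/-- A `[0, 1]`-valued function has an everywhere `[0, 1]`-valued conditional expectation. -/
theorem exists_condExp_ae_eq_mem_Icc_zero_one (hm : m ≤ m₀) [IsFiniteMeasure μ] {f : Y → ℝ}
    (hf : Measurable f) (hf01 : ∀ y, f y ∈ Set.Icc 0 1) :
    ∃ h : Y → ℝ, Measurable[m] h ∧ (∀ y, h y ∈ Set.Icc 0 1) ∧ h =ᵐ[μ] μ[f | m] := by
  have hfi := integrable_of_mem_Icc_zero_one (μ := μ) hf hf01
  have h₀ : 0 ≤ᵐ[μ] μ[f | m] := condExp_nonneg (.of_forall fun y => (hf01 y).1)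
  have h₁ : μ[f | m] ≤ᵐ[μ] μ[fun _ => (1 : ℝ) | m] :=
    condExp_mono hfi (integrable_const _) (.of_forall fun y => (hf01 y).2)
  rw [condExp_const hm] at h₁
  refine ⟨fun y => max 0 (min 1 ((μ[f | m]) y)), ?_, fun y => ⟨by simp, by simp⟩, ?_⟩
  · exact measurable_const.max (measurable_const.min stronglyMeasurable_condExp.measurable)
  · filter_upwards [h₀, h₁] with y hy₀ hy₁
    exact (congrArg (max 0) (min_eq_right hy₁)).trans (max_eq_right hy₀)

/-- Conditional expectations of a `[0, 1]`-valued function under close measures are close. -/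
theorem integral_abs_sub_le_of_setIntegral_eq (hm : m ≤ m₀) [IsFiniteMeasure μ]
    [IsFiniteMeasure ν] (hd : ∀ A, MeasurableSet A → |μ.real A - ν.real A| ≤ d)
    {f h k : Y → ℝ} (hf : Measurable f) (hf01 : ∀ y, f y ∈ Set.Icc 0 1)
    (hh : Measurable[m] h) (hh01 : ∀ y, h y ∈ Set.Icc 0 1)
    (hk : Measurable[m] k) (hk01 : ∀ y, k y ∈ Set.Icc 0 1)
    (hhf : ∀ C, MeasurableSet[m] C → ∫ y in C, h y ∂μ = ∫ y in C, f y ∂μ)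
    (hkf : ∀ C, MeasurableSet[m] C → ∫ y in C, k y ∂ν = ∫ y in C, f y ∂ν) :
    ∫ y, |h y - k y| ∂μ ≤ 4 * d := by
  have hhi := integrable_of_mem_Icc_zero_one (μ := μ) (hh.mono hm le_rfl) hh01
  have hki := integrable_of_mem_Icc_zero_one (μ := μ) (hk.mono hm le_rfl) hk01
  have key (C : Set Y) (hC : MeasurableSet[m] C) : |∫ y in C, h y - k y ∂μ| ≤ 2 * d := by
    have h₁ := abs_le.1 (abs_setIntegral_sub_setIntegral_le hd hf hf01 (hm C hC))
    have h₂ := abs_le.1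
      (abs_setIntegral_sub_setIntegral_le hd (hk.mono hm le_rfl) hk01 (hm C hC))
    rw [integral_sub hhi.integrableOn hki.integrableOn, hhf C hC, abs_le]
    rw [hkf C hC] at h₂
    exact ⟨by linarith, by linarith⟩
  have hC : MeasurableSet[m] {y | k y ≤ h y} := measurableSet_le hk hh
  have hpos : ∫ y in {y | k y ≤ h y}, |h y - k y| ∂μ = ∫ y in {y | k y ≤ h y}, h y - k y ∂μ :=
    setIntegral_congr_fun (hm _ hC) fun y hy => abs_of_nonneg (sub_nonneg.2 hy)
  have hneg : ∫ y in {y | k y ≤ h y}ᶜ, |h y - k y| ∂μ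
      = -∫ y in {y | k y ≤ h y}ᶜ, h y - k y ∂μ := by
    rw [← integral_neg]
    refine setIntegral_congr_fun (hm _ hC.compl) fun y hy => abs_of_nonpos (sub_nonpos.2 ?_)
    exact (not_le.1 (Set.notMem_ofPred_iff.1 hy)).le
  have habs : Integrable (fun y => |h y - k y|) μ := (hhi.sub hki).abs
  rw [← integral_add_compl (hm _ hC) habs, hpos, hneg]
  have h₁ := abs_le.1 (key _ hC)
  have h₂ := abs_le.1 (key _ hC.compl)
  linarith

/-- Factorisation of the conditional expectation of a product is stable under setwise uniform
convergence of measures. -/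
theorem condExp_mul_ae_eq_of_tendsto (hm : m ≤ m₀) [IsFiniteMeasure μ] {νs : ℕ → Measure Y}
    [∀ k, IsFiniteMeasure (νs k)] {ds : ℕ → ℝ}
    (hds : Filter.Tendsto ds Filter.atTop (nhds 0))
    (hd : ∀ k A, MeasurableSet A → |μ.real A - (νs k).real A| ≤ ds k)
    {f g : Y → ℝ} (hf : Measurable f) (hf01 : ∀ y, f y ∈ Set.Icc 0 1)
    (hg : Measurable g) (hg01 : ∀ y, g y ∈ Set.Icc 0 1)
    (hfac : ∀ k, (νs k)[f * g | m] =ᵐ[νs k] (νs k)[f | m] * (νs k)[g | m]) :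
    μ[f * g | m] =ᵐ[μ] μ[f | m] * μ[g | m] := by
  have mul01 {a b : Y → ℝ} (ha : ∀ y, a y ∈ Set.Icc 0 1) (hb : ∀ y, b y ∈ Set.Icc 0 1) (y : Y) :
      (a * b) y ∈ Set.Icc 0 1 :=
    ⟨mul_nonneg (ha y).1 (hb y).1, mul_le_one₀ (ha y).2 (hb y).1 (hb y).2⟩
  obtain ⟨p, hp, hp01, hpf⟩ := exists_condExp_ae_eq_mem_Icc_zero_one (μ := μ) hm hf hf01
  obtain ⟨q, hq, hq01, hqg⟩ := exists_condExp_ae_eq_mem_Icc_zero_one (μ := μ) hm hg hg01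
  refine Filter.EventuallyEq.trans ?_ (hpf.mul hqg)
  have hp' := hp.mono hm le_rfl
  have hq' := hq.mono hm le_rfl
  have setInt {ρ : Measure Y} [IsFiniteMeasure ρ] {a b : Y → ℝ} (ha : Measurable a)
      (ha01 : ∀ y, a y ∈ Set.Icc 0 1) (hb : b =ᵐ[ρ] ρ[a | m]) (C : Set Y)
      (hC : MeasurableSet[m] C) : ∫ y in C, b y ∂ρ = ∫ y in C, a y ∂ρ := by
    rw [← setIntegral_condExp hm (integrable_of_mem_Icc_zero_one ha ha01) hC]
    exact integral_congr_ae (ae_restrict_of_ae hb)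
  symm
  refine ae_eq_condExp_of_forall_setIntegral_eq hm
    (integrable_of_mem_Icc_zero_one (hf.mul hg) (mul01 hf01 hg01))
    (fun C _ _ =>
      (integrable_of_mem_Icc_zero_one (hp'.mul hq') (mul01 hp01 hq01)).integrableOn)
    (fun C hC _ => ?_) (hp.mul hq).stronglyMeasurable.aestronglyMeasurable
  refine eq_of_abs_sub_nonpos (ge_of_tendsto' (f := fun k => 10 * ds k)
    (x := Filter.atTop) (by simpa using hds.const_mul 10) fun k => ?_)
  obtain ⟨r, hr, hr01, hrf⟩ := exists_condExp_ae_eq_mem_Icc_zero_one (μ := νs k) hm hf hf01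
  obtain ⟨s, hs, hs01, hsg⟩ := exists_condExp_ae_eq_mem_Icc_zero_one (μ := νs k) hm hg hg01
  have hr' := hr.mono hm le_rfl
  have hs' := hs.mono hm le_rfl
  have h₁ := integral_abs_sub_le_of_setIntegral_eq hm (hd k) hf hf01 hp hp01 hr hr01
    (setInt hf hf01 hpf) (setInt hf hf01 hrf)
  have h₂ := integral_abs_sub_le_of_setIntegral_eq hm (hd k) hg hg01 hq hq01 hs hs01
    (setInt hg hg01 hqg) (setInt hg hg01 hsg)
  have h₃ := abs_le.1 (abs_setIntegral_sub_setIntegral_le (hd k) (hf.mul hg) (mul01 hf01 hg01)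
    (hm C hC))
  have h₄ := abs_le.1 (abs_setIntegral_sub_setIntegral_le (hd k) (hr'.mul hs') (mul01 hr01 hs01)
    (hm C hC))
  have h₅ : ∫ y in C, (r * s) y ∂(νs k) = ∫ y in C, (f * g) y ∂(νs k) :=
    setInt (hf.mul hg) (mul01 hf01 hg01) ((hrf.mul hsg).trans (hfac k).symm) C hC
  have hpi := integrable_of_mem_Icc_zero_one (μ := μ) hp' hp01
  have hqi := integrable_of_mem_Icc_zero_one (μ := μ) hq' hq01
  have hri := integrable_of_mem_Icc_zero_one (μ := μ) hr' hr01
  have hsi := integrable_of_mem_Icc_zero_one (μ := μ) hs' hs01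
  have hpqi := integrable_of_mem_Icc_zero_one (μ := μ) (hp'.mul hq') (mul01 hp01 hq01)
  have hrsi := integrable_of_mem_Icc_zero_one (μ := μ) (hr'.mul hs') (mul01 hr01 hs01)
  have h₆ : |∫ y in C, (p * q) y ∂μ - ∫ y in C, (r * s) y ∂μ|
      ≤ ∫ y, |p y - r y| ∂μ + ∫ y, |q y - s y| ∂μ := by
    have hpr : Integrable (fun y => |p y - r y|) μ := (hpi.sub hri).abs
    have hqs : Integrable (fun y => |q y - s y|) μ := (hqi.sub hsi).abs
    rw [← integral_sub hpqi.integrableOn hrsi.integrableOn, ← integral_add hpr hqs]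
    refine abs_integral_le_integral_abs.trans ((setIntegral_le_integral (hpqi.sub hrsi).abs
      (.of_forall fun y => abs_nonneg _)).trans (integral_mono (hpqi.sub hrsi).abs
        (hpr.add hqs) fun y => ?_))
    have : (p * q) y - (r * s) y = (p y - r y) * q y + r y * (q y - s y) := by
      simp only [Pi.mul_apply]; ring
    simp only [Pi.sub_apply]
    rw [this]
    refine (abs_add_le _ _).trans (add_le_add ?_ ?_)
    · rw [abs_mul, abs_of_nonneg (hq01 y).1]
      exact mul_le_of_le_one_right (abs_nonneg _) (hq01 y).2
    · rw [abs_mul, abs_of_nonneg (hr01 y).1]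
      exact mul_le_of_le_one_left (abs_nonneg _) (hr01 y).2
  have h₇ := abs_le.1 h₆
  simp only [Pi.mul_apply] at *
  exact abs_le.2 ⟨by linarith, by linarith⟩

/-- Conditional expectations commute with pulling back along a random variable. -/
theorem condExp_comp_ae_eq_comp_condExp {Ω : Type*} {mΩ : MeasurableSpace Ω} {P : Measure Ω}
    [IsFiniteMeasure P] (hm : m ≤ m₀) {X : Ω → Y} (hX : Measurable X) {f : Y → ℝ}
    (hf : Integrable f (P.map X)) :
    P[f ∘ X | m.comap X] =ᵐ[P] ((P.map X)[f | m]) ∘ X := by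
  have hle : m.comap X ≤ mΩ := (MeasurableSpace.comap_mono hm).trans hX.comap_le
  have hsm : StronglyMeasurable[m] ((P.map X)[f | m]) := stronglyMeasurable_condExp
  have hci : Integrable ((P.map X)[f | m] ∘ X) P :=
    (integrable_map_measure (hsm.mono hm).aestronglyMeasurable hX.aemeasurable).1
      integrable_condExp
  symm
  refine ae_eq_condExp_of_forall_setIntegral_eq hle
    ((integrable_map_measure hf.aestronglyMeasurable hX.aemeasurable).1 hf)
    (fun _ _ _ => hci.integrableOn) ?_
    (hsm.comp_measurable (comap_measurable X)).aestronglyMeasurable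
  rintro _ ⟨C, hC, rfl⟩ -
  have h := setIntegral_condExp hm hf hC
  rwa [setIntegral_map (hm C hC) (hsm.mono hm).aestronglyMeasurable hX.aemeasurable,
    setIntegral_map (hm C hC) hf.aestronglyMeasurable hX.aemeasurable] at h

end TotalVariation

theorem evtInd_mem_Icc_zero_one {Ω α : Type*} (S : Ω → α) (A : Set α) (ω : Ω) :
    evtInd S A ω ∈ Set.Icc 0 1 := by
  by_cases h : ω ∈ S ⁻¹' A <;> simp [evtInd, Set.indicator, h]

theorem measurable_evtInd {Ω α : Type*} [MeasurableSpace Ω] [MeasurableSpace α] {S : Ω → α}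
    (hS : Measurable S) {A : Set α} (hA : MeasurableSet A) : Measurable (evtInd S A) :=
  measurable_const.indicator (hS hA)

/-- Conditional independence depends only on the joint law. -/
theorem CondIndepRV.comp {Ω Y α β γ : Type*} [MeasurableSpace Ω] [MeasurableSpace Y]
    [MeasurableSpace α] [MeasurableSpace β] [MeasurableSpace γ] {P : Measure Ω}
    [IsFiniteMeasure P] {X : Ω → Y} (hX : Measurable X) {S : Y → α} {W : Y → β} {Z : Y → γ}
    (hS : Measurable S) (hW : Measurable W) (hZ : Measurable Z)
    (h : CondIndepRV (P.map X) S W Z) :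
    CondIndepRV P (S ∘ X) (W ∘ X) (Z ∘ X) := by
  intro A B hA hB
  have hSA := measurable_evtInd hS hA
  have hWB := measurable_evtInd hW hB
  have hSi := integrable_of_mem_Icc_zero_one (μ := P.map X) hSA (evtInd_mem_Icc_zero_one S A)
  have hWi := integrable_of_mem_Icc_zero_one (μ := P.map X) hWB (evtInd_mem_Icc_zero_one W B)
  have hSWi : Integrable (evtInd S A * evtInd W B) (P.map X) :=
    integrable_of_mem_Icc_zero_one (hSA.mul hWB) fun y =>
      ⟨mul_nonneg (evtInd_mem_Icc_zero_one S A y).1 (evtInd_mem_Icc_zero_one W B y).1,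
        mul_le_one₀ (evtInd_mem_Icc_zero_one S A y).2 (evtInd_mem_Icc_zero_one W B y).1
          (evtInd_mem_Icc_zero_one W B y).2⟩
  rw [← MeasurableSpace.comap_comp]
  have hle := hZ.comap_le
  have hlaw := Filter.EventuallyEq.comp_tendsto (h A B hA hB)
    (Measure.tendsto_ae_map hX.aemeasurable)
  exact (condExp_comp_ae_eq_comp_condExp hle hX hSWi).trans (hlaw.trans
      ((condExp_comp_ae_eq_comp_condExp hle hX hSi).mul
        (condExp_comp_ae_eq_comp_condExp hle hX hWi)).symm)

/-- The set `P_G(X)` of `G`-compatible probability measures is closed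
under convergence in total variation. -/
theorem isGComp_closed_totalVariation {n : ℕ} (E : Fin n → Fin n → Prop)
    (hE : ∀ i j, E i j → i < j) (𝒳 : Fin n → Type)
    [∀ i, TopologicalSpace (𝒳 i)] [∀ i, PolishSpace (𝒳 i)]
    [∀ i, MeasurableSpace (𝒳 i)] [∀ i, BorelSpace (𝒳 i)] [∀ i, Nonempty (𝒳 i)]
    (μs : ℕ → Measure (∀ i, 𝒳 i)) (μ : Measure (∀ i, 𝒳 i))
    (hprob : ∀ k, IsProbabilityMeasure (μs k)) (hμ : IsProbabilityMeasure μ)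
    (hcomp : ∀ k, IsGComp E 𝒳 (μs k))
    (htv : Filter.Tendsto (fun k => tvDist (μs k) μ) Filter.atTop (nhds 0)) :
    IsGComp E 𝒳 μ := by
  intro Ω _ P hP X hX hPX i hi
  subst hPX
  refine CondIndepRV.comp hX (S := fun x : ∀ i, 𝒳 i => x i)
    (W := fun (x : ∀ i, 𝒳 i) (j : {k : Fin n // (k : ℕ) < (i : ℕ)}) => x j.1)
    (Z := fun (x : ∀ i, 𝒳 i) (j : {k : Fin n // E k i}) => x j.1)
    (by fun_prop) (by fun_prop) (by fun_prop) fun A B hA hB => ?_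
  refine condExp_mul_ae_eq_of_tendsto (Measurable.comap_le (by fun_prop)) (νs := μs)
    (ds := fun k => (tvDist (μs k) (P.map X)).toReal)
    ((ENNReal.tendsto_toReal ENNReal.zero_ne_top).comp htv)
    (fun k C hC => by
      rw [abs_sub_comm]
      exact abs_measureReal_sub_le_toReal_tvDist hC)
    (measurable_evtInd (by fun_prop) hA) (evtInd_mem_Icc_zero_one _ _)
    (measurable_evtInd (by fun_prop) hB) (evtInd_mem_Icc_zero_one _ _) fun k => ?_
  exact hcomp k _ _ (μs k) (hprob k) id measurable_id Measure.map_id i hi A B hA hB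
end

section
/- Let G be a sorted DAG on {1,…,n} and X = X_1×…×X_n where each X_i is a countable discrete Polish space. Then the set P_G(X) of G-compatible Borel probability measures on X is weakly closed, i.e. closed under weak convergence of probability measures. -/
open MeasureTheory ProbabilityTheory
open scoped ENNReal

/-- Weak convergence of a sequence of measures: convergence of the integrals of all bounded
continuous functions. -/
def WeakTendsto {X : Type*} [MeasurableSpace X] [TopologicalSpace X]
    (μs : ℕ → Measure X) (μ : Measure X) : Prop :=
  ∀ f : BoundedContinuousFunction X ℝ,
    Filter.Tendsto (fun k => ∫ x, f x ∂(μs k)) Filter.atTop (nhds (∫ x, f x ∂μ))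

/-- The conditional expectation given `σ(Z)` is constant on each fibre of `Z`, where it is the
average of `f`. -/
theorem condExp_comap_mul_measureReal_fibre {Ω γ : Type*} [MeasurableSpace Ω]
    [MeasurableSpace γ] [MeasurableSingletonClass γ] (P : Measure Ω) [IsProbabilityMeasure P]
    {Z : Ω → γ} (hZ : Measurable Z) {f : Ω → ℝ} (hf : Integrable f P) (ω : Ω) :
    (P[f | MeasurableSpace.comap Z inferInstance]) ω * P.real (Z ⁻¹' {Z ω})
      = ∫ x in Z ⁻¹' {Z ω}, f x ∂P := by
  have hm := hZ.comap_le
  set g := P[f | MeasurableSpace.comap Z inferInstance] with hg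
  have hfib : MeasurableSet[MeasurableSpace.comap Z inferInstance] (Z ⁻¹' {Z ω}) :=
    ⟨_, measurableSet_singleton _, rfl⟩
  have hconst : ∀ x ∈ Z ⁻¹' {Z ω}, g x = g ω := by
    obtain ⟨T, -, hT⟩ : MeasurableSet[MeasurableSpace.comap Z inferInstance] (g ⁻¹' {g ω}) :=
      stronglyMeasurable_condExp.measurable (measurableSet_singleton _)
    intro x hx
    have hω : ω ∈ Z ⁻¹' T := hT ▸ rfl
    have hxT : x ∈ Z ⁻¹' T := by
      rw [Set.mem_preimage, show Z x = Z ω from hx]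
      exact hω
    rw [hT] at hxT
    exact hxT
  rw [← setIntegral_condExp hm hf hfib, ← hg, setIntegral_congr_fun (hm _ hfib) hconst,
    setIntegral_const, smul_eq_mul, mul_comm]

/-- Almost every point lies in a fibre of positive measure, if there are countably many fibres. -/
theorem ae_measureReal_fibre_ne_zero {Ω γ : Type*} [MeasurableSpace Ω] [Countable γ]
    (P : Measure Ω) [IsFiniteMeasure P] (Z : Ω → γ) :
    ∀ᵐ ω ∂P, P.real (Z ⁻¹' {Z ω}) ≠ 0 := by
  rw [ae_iff]
  refine measure_mono_null (t := ⋃ z ∈ {z | P (Z ⁻¹' {z}) = 0}, Z ⁻¹' {z}) ?_ ?_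
  · intro ω hω
    simpa [measureReal_eq_zero_iff] using hω
  · exact (measure_biUnion_null_iff (Set.to_countable _)).2 fun z hz => hz

theorem evtInd_mul_evtInd {Ω α β : Type*} (S : Ω → α) (W : Ω → β) (A : Set α) (B : Set β) :
    evtInd S A * evtInd W B = (S ⁻¹' A ∩ W ⁻¹' B).indicator fun _ => (1 : ℝ) := by
  simp only [evtInd, Pi.mul_def, mul_one, ← Set.inter_indicator_mul]

/-- Given a variable with countably many values, conditional independence is a family of
product identities on its fibres. -/
theorem condIndepRV_iff_of_countable {Ω α β γ : Type*} [MeasurableSpace Ω] [MeasurableSpace α]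
    [MeasurableSpace β] [MeasurableSpace γ] [MeasurableSingletonClass γ] [Countable γ]
    (P : Measure Ω) [IsProbabilityMeasure P] {S : Ω → α} {W : Ω → β} {Z : Ω → γ}
    (hS : Measurable S) (hW : Measurable W) (hZ : Measurable Z) :
    CondIndepRV P S W Z ↔ ∀ (A : Set α) (B : Set β), MeasurableSet A → MeasurableSet B → ∀ z : γ,
      P.real (S ⁻¹' A ∩ W ⁻¹' B ∩ Z ⁻¹' {z}) * P.real (Z ⁻¹' {z})
        = P.real (S ⁻¹' A ∩ Z ⁻¹' {z}) * P.real (W ⁻¹' B ∩ Z ⁻¹' {z}) := by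
  refine forall₄_congr fun A B hA hB => ?_
  have condExp_fibre : ∀ D : Set Ω, MeasurableSet D → ∀ ω,
      (P[D.indicator fun _ => (1 : ℝ) | MeasurableSpace.comap Z inferInstance]) ω
        * P.real (Z ⁻¹' {Z ω}) = P.real (D ∩ Z ⁻¹' {Z ω}) := by
    intro D hD ω
    rw [condExp_comap_mul_measureReal_fibre P hZ ((integrable_const 1).indicator hD),
      integral_indicator_const _ hD, measureReal_restrict_apply hD, smul_eq_mul, mul_one]
  have hSA := condExp_fibre _ (hS hA)
  have hWB := condExp_fibre _ (hW hB)
  have hSW := condExp_fibre _ ((hS hA).inter (hW hB))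
  rw [evtInd_mul_evtInd]
  constructor
  · intro h z
    by_cases hz : P.real (Z ⁻¹' {z}) = 0
    · have hnull : P.real (S ⁻¹' A ∩ Z ⁻¹' {z}) = 0 :=
        measureReal_mono_null Set.inter_subset_right hz
      rw [hz, hnull, mul_zero, zero_mul]
    · have hfreq : ∃ᵐ ω ∂P, ω ∈ Z ⁻¹' {z} :=
        frequently_ae_mem_iff.2 fun h0 => hz (by rw [measureReal_def, h0, ENNReal.toReal_zero])
      obtain ⟨ω, rfl, hω⟩ := (hfreq.and_eventually h).exists
      rw [← hSW, ← hSA, ← hWB, hω, Pi.mul_apply]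
      simp only [evtInd]
      ring
  · intro h
    filter_upwards [ae_measureReal_fibre_ne_zero P Z] with ω hω
    have hprod := h (Z ω)
    rw [← hSW, ← hSA, ← hWB] at hprod
    refine mul_right_cancel₀ hω (mul_right_cancel₀ hω ?_)
    rw [hprod, Pi.mul_apply]
    simp only [evtInd]
    ring

theorem WeakTendsto.tendsto_measureReal {X : Type*} [MeasurableSpace X] [TopologicalSpace X]
    [OpensMeasurableSpace X] {μs : ℕ → Measure X} {μ : Measure X} (h : WeakTendsto μs μ)
    {D : Set X} (hD : IsClopen D) :
    Filter.Tendsto (fun k => (μs k).real D) Filter.atTop (nhds (μ.real D)) := by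
  have hlim := h (BoundedContinuousFunction.indicator D hD)
  simpa [integral_indicator_one hD.isOpen.measurableSet] using hlim

/-- If each `𝒳 i` is a countable discrete Polish space, the set `P_G(X)`
of `G`-compatible probability measures is weakly closed. -/
theorem isGComp_weakly_closed_of_discrete {n : ℕ} (E : Fin n → Fin n → Prop)
    (hE : ∀ i j, E i j → i < j) (𝒳 : Fin n → Type)
    [∀ i, TopologicalSpace (𝒳 i)] [∀ i, PolishSpace (𝒳 i)]
    [∀ i, MeasurableSpace (𝒳 i)] [∀ i, BorelSpace (𝒳 i)] [∀ i, Nonempty (𝒳 i)]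
    [∀ i, Countable (𝒳 i)] [∀ i, DiscreteTopology (𝒳 i)]
    (μs : ℕ → Measure (∀ i, 𝒳 i)) (μ : Measure (∀ i, 𝒳 i))
    (hprob : ∀ k, IsProbabilityMeasure (μs k)) (hμ : IsProbabilityMeasure μ)
    (hcomp : ∀ k, IsGComp E 𝒳 (μs k))
    (hweak : WeakTendsto μs μ) :
    IsGComp E 𝒳 μ := by
  intro Ω _ P _ X hX hmap i hi
  have measurable_restr : ∀ p : Fin n → Prop,
      Measurable fun (x : ∀ i, 𝒳 i) (j : {k : Fin n // p k}) => x j.1 :=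
    fun p => measurable_pi_lambda _ fun j => measurable_pi_apply _
  have hS : Measurable fun x : ∀ i, 𝒳 i => x i := measurable_pi_apply i
  have hW := measurable_restr fun k => (k : ℕ) < (i : ℕ)
  have hZ := measurable_restr fun k => E k i
  refine (condIndepRV_iff_of_countable P (hS.comp hX) (hW.comp hX) (hZ.comp hX)).2 ?_
  intro A B hA hB z
  have hlim : ∀ D : Set (∀ i, 𝒳 i),
      Filter.Tendsto (fun k => (μs k).real D) Filter.atTop (nhds (P.real (X ⁻¹' D))) := by
    intro D
    rw [← map_measureReal_apply hX (isOpen_discrete D).measurableSet, hmap]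
    exact hweak.tendsto_measureReal (isClopen_discrete D)
  have fibre_identity := fun k => (condIndepRV_iff_of_countable (μs k) hS hW hZ).1
    (hcomp k _ _ (μs k) (hprob k) id measurable_id Measure.map_id i hi) A B hA hB z
  have limit_identity := tendsto_nhds_unique
    (((hlim _).mul (hlim _)).congr fibre_identity) ((hlim _).mul (hlim _))
  exact limit_identity
end

section
/- Let G be the Markovian graph on V = {1,2,3} with edges E = {(1,2),(2,3)}, and let X = [-1,1]^3 with the Borel σ-algebra. The measures μ^k = ½ δ_{(1,1/k,1)} + ½ δ_{(-1,-1/k,-1)}, k ∈ ℕ, are G-compatible for every k and converge weakly to μ = ½ δ_{(1,0,1)} + ½ δ_{(-1,0,-1)}, which is not G-compatible. Hence the set of G-compatible measures on [-1,1]^3 is not weakly closed. -/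
open MeasureTheory ProbabilityTheory
open scoped ENNReal

namespace Stmt5

/-- The Polish space `[-1, 1]`. -/
abbrev I3 : Type := ↥(Set.Icc (-1 : ℝ) 1)

/-- The Markovian graph `1 → 2 → 3` on three vertices. -/
def E3 : Fin 3 → Fin 3 → Prop := fun i j => (i = 0 ∧ j = 1) ∨ (i = 1 ∧ j = 2)

def one : I3 := ⟨1, by norm_num⟩
def negOne : I3 := ⟨-1, by norm_num⟩
def zero : I3 := ⟨0, by norm_num⟩

noncomputable def invK (k : ℕ) : I3 :=
  ⟨((k : ℝ) + 1)⁻¹, by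
    constructor
    · have : (0 : ℝ) ≤ ((k : ℝ) + 1)⁻¹ := by positivity
      linarith
    · have hk : (1 : ℝ) ≤ (k : ℝ) + 1 := by
        have : (0:ℝ) ≤ (k : ℝ) := Nat.cast_nonneg k
        linarith
      have h0 : (0 : ℝ) < (k : ℝ) + 1 := by positivity
      rw [inv_le_one_iff₀]
      right; exact hk⟩

noncomputable def negInvK (k : ℕ) : I3 :=
  ⟨-((k : ℝ) + 1)⁻¹, by
    constructor
    · have hk : (1 : ℝ) ≤ (k : ℝ) + 1 := by
        have : (0:ℝ) ≤ (k : ℝ) := Nat.cast_nonneg k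
        linarith
      have h1 : ((k : ℝ) + 1)⁻¹ ≤ 1 := by
        rw [inv_le_one_iff₀]; right; exact hk
      linarith
    · have : (0 : ℝ) ≤ ((k : ℝ) + 1)⁻¹ := by positivity
      linarith⟩

/-- The measures `μ^k = ½ δ_(1, 1/k, 1) + ½ δ_(-1, -1/k, -1)`. -/
noncomputable def μk (k : ℕ) : Measure (∀ _ : Fin 3, I3) :=
  (2 : ℝ≥0∞)⁻¹ • Measure.dirac ![one, invK k, one] +
    (2 : ℝ≥0∞)⁻¹ • Measure.dirac ![negOne, negInvK k, negOne]

/-- The limit measure `μ = ½ δ_(1, 0, 1) + ½ δ_(-1, 0, -1)`. -/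
noncomputable def μlim : Measure (∀ _ : Fin 3, I3) :=
  (2 : ℝ≥0∞)⁻¹ • Measure.dirac ![one, zero, one] +
    (2 : ℝ≥0∞)⁻¹ • Measure.dirac ![negOne, zero, negOne]

/-- If `W` is almost surely a measurable function of `Z`, then anything is conditionally
independent of `W` given `Z`. -/
lemma condIndepRV_of_ae_eq_comp {Ω α β γ : Type*} [MeasurableSpace Ω] [MeasurableSpace α]
    [MeasurableSpace β] [MeasurableSpace γ] {P : Measure Ω} [IsFiniteMeasure P]
    {S : Ω → α} {W : Ω → β} {Z : Ω → γ} (hS : Measurable S) (hZ : Measurable Z)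
    {g : γ → β} (hg : Measurable g) (hW : W =ᵐ[P] g ∘ Z) :
    CondIndepRV P S W Z := by
  intro A B hA hB
  have hWB : evtInd W B =ᵐ[P] evtInd (g ∘ Z) B := by
    filter_upwards [hW] with ω hω
    by_cases h : g (Z ω) ∈ B <;> simp_all [evtInd, Set.indicator]
  have hsm : StronglyMeasurable[MeasurableSpace.comap Z inferInstance] (evtInd (g ∘ Z) B) :=
    stronglyMeasurable_const.indicator ⟨g ⁻¹' B, hg hB, rfl⟩
  have hSint : Integrable (evtInd S A) P := (integrable_const 1).indicator (hS hA)
  have hZint : Integrable (evtInd (g ∘ Z) B) P :=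
    (integrable_const 1).indicator ((hg.comp hZ) hB)
  have hmul : Integrable (evtInd S A * evtInd (g ∘ Z) B) P := by
    have : evtInd S A * evtInd (g ∘ Z) B =
        (S ⁻¹' A ∩ (g ∘ Z) ⁻¹' B).indicator fun _ => (1 : ℝ) := by
      ext ω
      by_cases h₁ : S ω ∈ A <;> by_cases h₂ : g (Z ω) ∈ B <;> simp [evtInd, Set.indicator, h₁, h₂]
    rw [this]
    exact (integrable_const 1).indicator ((hS hA).inter ((hg.comp hZ) hB))
  have hprod : P[evtInd S A * evtInd W B | MeasurableSpace.comap Z inferInstance] =ᵐ[P]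
      P[evtInd S A * evtInd (g ∘ Z) B | MeasurableSpace.comap Z inferInstance] :=
    condExp_congr_ae (hWB.mono fun ω hω => by simp [hω])
  have hright : P[evtInd W B | MeasurableSpace.comap Z inferInstance] =ᵐ[P]
      evtInd (g ∘ Z) B := by
    refine (condExp_congr_ae hWB).trans ?_
    rw [condExp_of_stronglyMeasurable hZ.comap_le hsm hZint]
  filter_upwards [hprod, hright, condExp_mul_of_stronglyMeasurable_right hsm hmul hSint]
    with ω h₁ h₂ h₃
  rw [h₁, h₃, Pi.mul_apply, Pi.mul_apply, h₂]

section TwoPoint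

variable {α : Type*} [MeasurableSpace α]

lemma isProbabilityMeasure_half_dirac (x y : α) :
    IsProbabilityMeasure
      ((2 : ℝ≥0∞)⁻¹ • Measure.dirac x + (2 : ℝ≥0∞)⁻¹ • Measure.dirac y) :=
  ⟨by simp [ENNReal.inv_two_add_inv_two]⟩

variable [MeasurableSingletonClass α]

lemma ae_half_dirac_iff {x y : α} {p : α → Prop} :
    (∀ᵐ z ∂((2 : ℝ≥0∞)⁻¹ • Measure.dirac x + (2 : ℝ≥0∞)⁻¹ • Measure.dirac y), p z) ↔
      p x ∧ p y := by
  have h2 : (2 : ℝ≥0∞)⁻¹ ≠ 0 := by simp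
  rw [ae_add_measure_iff, Measure.ae_ennreal_smul_measure_iff h2,
    Measure.ae_ennreal_smul_measure_iff h2, ae_dirac_eq, ae_dirac_eq]
  simp

lemma integral_half_dirac (x y : α) (f : α → ℝ) :
    ∫ z, f z ∂((2 : ℝ≥0∞)⁻¹ • Measure.dirac x + (2 : ℝ≥0∞)⁻¹ • Measure.dirac y) =
      2⁻¹ * f x + 2⁻¹ * f y := by
  have h2 : (2 : ℝ≥0∞)⁻¹ ≠ ∞ := by simp
  rw [integral_add_measure ((integrable_dirac (by simp)).smul_measure h2)
    ((integrable_dirac (by simp)).smul_measure h2), integral_smul_measure,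
    integral_smul_measure, integral_dirac, integral_dirac]
  simp

/-- Under a two-point measure, a variable `Z` identifying both atoms carries no information,
so variables `S`, `W` that both separate the atoms are not conditionally independent
given `Z`. -/
lemma not_condIndepRV_half_dirac {β γ δ : Type*} [MeasurableSpace β] [MeasurableSpace γ]
    [MeasurableSpace δ] {x y : α} {S : α → β} {W : α → γ} {Z : α → δ} (hZ : Measurable Z)
    {A : Set β} {B : Set γ} (hA : MeasurableSet A) (hB : MeasurableSet B)
    (hxA : S x ∈ A) (hyA : S y ∉ A) (hxB : W x ∈ B) (hyB : W y ∉ B) (hxy : Z x = Z y) :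
    ¬ CondIndepRV ((2 : ℝ≥0∞)⁻¹ • Measure.dirac x + (2 : ℝ≥0∞)⁻¹ • Measure.dirac y) S W Z := by
  intro h
  have hprob := isProbabilityMeasure_half_dirac x y
  have hcond := h A B hA hB
  have hSx : evtInd S A x = 1 := Set.indicator_of_mem (s := S ⁻¹' A) hxA _
  have hSy : evtInd S A y = 0 := Set.indicator_of_notMem (s := S ⁻¹' A) hyA _
  have hWx : evtInd W B x = 1 := Set.indicator_of_mem (s := W ⁻¹' B) hxB _
  have hWy : evtInd W B y = 0 := Set.indicator_of_notMem (s := W ⁻¹' B) hyB _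
  have value (f : α → ℝ) (hfx : f x = 1) (hfy : f y = 0) :
      (((2 : ℝ≥0∞)⁻¹ • Measure.dirac x + (2 : ℝ≥0∞)⁻¹ • Measure.dirac y)[f |
        MeasurableSpace.comap Z inferInstance]) x = 2⁻¹ := by
    have hint := integral_condExp (f := f)
      (μ := (2 : ℝ≥0∞)⁻¹ • Measure.dirac x + (2 : ℝ≥0∞)⁻¹ • Measure.dirac y) hZ.comap_le
    rw [integral_half_dirac, integral_half_dirac,
      ← stronglyMeasurable_condExp.factorsThrough hxy, hfx, hfy] at hint
    linarith
  have hx := (ae_half_dirac_iff.mp hcond).1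
  rw [Pi.mul_apply, value _ (by simp [hSx, hWx]) (by simp [hSy]), value _ hSx hSy,
    value _ hWx hWy] at hx
  norm_num at hx

end TwoPoint

lemma isGComp_μk (k : ℕ) : IsGComp E3 (fun _ => I3) (μk k) := by
  intro Ω _ P _ X hX hmap i hi
  have hXi (i : Fin 3) : Measurable fun ω => X ω i := (measurable_pi_apply i).comp hX
  have hXZ : Measurable fun ω (j : {l : Fin 3 // E3 l i}) => X ω j.1 :=
    measurable_pi_lambda _ fun j => hXi j.1
  have hpos : (0 : ℝ) < ((k : ℝ) + 1)⁻¹ := by positivity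
  obtain rfl | rfl : i = 1 ∨ i = 2 := by
    fin_cases i <;> simp at hi ⊢
  · refine condIndepRV_of_ae_eq_comp (hXi 1) hXZ
      (g := fun z _ => z ⟨0, Or.inl ⟨rfl, rfl⟩⟩)
      (measurable_pi_lambda _ fun _ => measurable_pi_apply _) (.of_forall fun ω => ?_)
    ext1 ⟨j, hj⟩
    obtain rfl : j = 0 := by
      fin_cases j <;> simp at hj ⊢
    rfl
  · have hsign : ∀ᵐ ω ∂P, X ω 0 = if (0 : ℝ) < X ω 1 then one else negOne := by
      refine ae_of_ae_map
        (p := fun x : Fin 3 → I3 => x 0 = if (0 : ℝ) < x 1 then one else negOne)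
        hX.aemeasurable ?_
      rw [hmap]
      exact ae_half_dirac_iff.mpr
        ⟨by simp [invK, hpos], (if_neg (not_lt.mpr (neg_nonpos.mpr hpos.le))).symm⟩
    refine condIndepRV_of_ae_eq_comp (hXi 2) hXZ
      (g := fun z j => if j.1 = 0 then
        (if (0 : ℝ) < z ⟨1, Or.inr ⟨rfl, rfl⟩⟩ then one else negOne)
        else z ⟨1, Or.inr ⟨rfl, rfl⟩⟩)
      (measurable_pi_lambda _ fun j => ?_) ?_
    · split_ifs
      · exact Measurable.ite (measurableSet_lt measurable_const
          (measurable_subtype_coe.comp (measurable_pi_apply _))) measurable_const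
          measurable_const
      · exact measurable_pi_apply _
    · filter_upwards [hsign] with ω hω
      ext1 ⟨j, hj⟩
      obtain rfl | rfl : j = 0 ∨ j = 1 := by
        fin_cases j <;> simp at hj ⊢
      · simpa using hω
      · simp

lemma weakTendsto_μk : WeakTendsto μk μlim := by
  intro f
  simp only [μk, μlim, integral_half_dirac]
  have hinv : Filter.Tendsto (fun k : ℕ => ((k : ℝ) + 1)⁻¹) Filter.atTop (nhds 0) := by
    simpa using tendsto_one_div_add_atTop_nhds_zero_nat (𝕜 := ℝ)
  have hpos : Filter.Tendsto invK Filter.atTop (nhds zero) :=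
    tendsto_subtype_rng.mpr hinv
  have hneg : Filter.Tendsto negInvK Filter.atTop (nhds zero) :=
    tendsto_subtype_rng.mpr (by simpa [zero, negInvK] using hinv.neg)
  have hvec (a b : I3) {u : ℕ → I3} (hu : Filter.Tendsto u Filter.atTop (nhds zero)) :
      Filter.Tendsto (fun k => f ![a, u k, b]) Filter.atTop (nhds (f ![a, zero, b])) := by
    refine (f.continuous.tendsto _).comp (tendsto_pi_nhds.mpr fun i => ?_)
    fin_cases i
    · exact tendsto_const_nhds
    · exact hu
    · exact tendsto_const_nhds
  exact ((hvec one one hpos).const_mul _).add ((hvec negOne negOne hneg).const_mul _)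

lemma not_isGComp_μlim : ¬ IsGComp E3 (fun _ => I3) μlim := by
  intro h
  have hne : negOne ≠ one := fun h => by
    have := congrArg Subtype.val h
    norm_num [one, negOne] at this
  let first : {l : Fin 3 // (l : ℕ) < ((2 : Fin 3) : ℕ)} := ⟨0, by norm_num⟩
  refine not_condIndepRV_half_dirac (A := {one})
    (B := (fun w => w first) ⁻¹' {one})
    (measurable_pi_lambda _ fun j => measurable_pi_apply _)
    (measurableSet_singleton _) (measurable_pi_apply first (measurableSet_singleton one))
    ?_ ?_ ?_ ?_ ?_
    (h _ inferInstance μlim (isProbabilityMeasure_half_dirac _ _) id measurable_id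
      Measure.map_id 2 (by norm_num))
  · simp
  · simpa using hne
  · simp [first]
  · simpa [first] using hne
  · ext1 ⟨j, hj⟩
    obtain rfl : j = 1 := by simpa [E3] using hj
    rfl

/-- For the Markovian graph on `{1,2,3}` and `X = [-1,1]³`, the measures
`μ^k` are `G`-compatible, converge weakly to `μ`, which is not `G`-compatible; hence the set
of `G`-compatible measures on `[-1,1]³` is not weakly closed. -/
theorem not_weakly_closed :
    (∀ k : ℕ, IsGComp E3 (fun _ => I3) (μk k)) ∧
    WeakTendsto μk μlim ∧
    ¬ IsGComp E3 (fun _ => I3) μlim ∧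
    ¬ (∀ (ρs : ℕ → Measure (∀ _ : Fin 3, I3)) (ρ : Measure (∀ _ : Fin 3, I3)),
        (∀ k, IsProbabilityMeasure (ρs k)) → IsProbabilityMeasure ρ →
        (∀ k, IsGComp E3 (fun _ => I3) (ρs k)) → WeakTendsto ρs ρ →
        IsGComp E3 (fun _ => I3) ρ) := by
  refine ⟨isGComp_μk, weakTendsto_μk, not_isGComp_μlim, fun h => not_isGComp_μlim ?_⟩
  exact h μk μlim (fun k => isProbabilityMeasure_half_dirac _ _)
    (isProbabilityMeasure_half_dirac _ _) isGComp_μk weakTendsto_μk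

end Stmt5
end

section
/- Let G be a sorted DAG on {1,…,n}, X = X_1×…×X_n and Y = Y_1×…×Y_n products of nonempty Polish spaces, μ a G-compatible Borel probability measure on X, ν a Borel probability measure on Y, and π a coupling of μ and ν with (X,Y) ~ π. Then the following are equivalent: (ii) Y_i ⫫_{(X_i, X_{pa_i}, Y_{pa_i})} (X, Y_{1:i-1}) for all i = 1,…,n; (iii) X_i ⫫_{X_{pa_i}} (X_{1:i-1}, Y_{1:i-1}) and Y_i ⫫_{(X_i, X_{pa_i}, Y_{pa_i})} (X_{1:i}, Y_{1:i-1}) for all i = 1,…,n. -/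
open MeasureTheory ProbabilityTheory
open scoped ENNReal

/-- `π` is a coupling of `μ` and `ν`. -/
def IsCoupling {X Y : Type*} [MeasurableSpace X] [MeasurableSpace Y]
    (μ : Measure X) (ν : Measure Y) (π : Measure (X × Y)) : Prop :=
  π.map Prod.fst = μ ∧ π.map Prod.snd = ν

section ConditionalIndependence

theorem mul_indicator_one {Ω : Type*} (f : Ω → ℝ) (t : Set Ω) :
    (f * t.indicator fun _ => (1 : ℝ)) = t.indicator f := by
  ext ω
  by_cases h : ω ∈ t <;> simp [h]

theorem MeasurableSpace.sup_eq_generateFrom_inter {Ω : Type*} (m₁ m₂ : MeasurableSpace Ω) :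
    m₁ ⊔ m₂ = MeasurableSpace.generateFrom
      {u | ∃ s t, MeasurableSet[m₁] s ∧ MeasurableSet[m₂] t ∧ s ∩ t = u} := by
  apply le_antisymm
  · refine sup_le (fun s hs => ?_) (fun t ht => ?_)
    · exact MeasurableSpace.measurableSet_generateFrom
        ⟨s, Set.univ, hs, MeasurableSet.univ, Set.inter_univ s⟩
    · exact MeasurableSpace.measurableSet_generateFrom
        ⟨Set.univ, t, MeasurableSet.univ, ht, Set.univ_inter t⟩
  · refine MeasurableSpace.generateFrom_le ?_
    rintro _ ⟨s, t, hs, ht, rfl⟩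
    exact MeasurableSet.inter ((le_sup_left : m₁ ≤ m₁ ⊔ m₂) s hs)
      ((le_sup_right : m₂ ≤ m₁ ⊔ m₂) t ht)

theorem isPiSystem_inter_measurableSet {Ω : Type*} (m₁ m₂ : MeasurableSpace Ω) :
    IsPiSystem {u : Set Ω | ∃ s t, MeasurableSet[m₁] s ∧ MeasurableSet[m₂] t ∧ s ∩ t = u} := by
  rintro _ ⟨s, t, hs, ht, rfl⟩ _ ⟨s', t', hs', ht', rfl⟩ -
  exact ⟨s ∩ s', t ∩ t', MeasurableSet.inter hs hs', MeasurableSet.inter ht ht',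
    Set.inter_inter_inter_comm s s' t t'⟩

variable {Ω : Type*} {mA mA' mC mC' mD mE mE' mΩ : MeasurableSpace Ω} {P : Measure Ω}

/-- Two integrable functions with the same integrals over the sets `s ∩ t`, with `s` measurable
for `m₁` and `t` for `m₂`, have the same integrals over all `m₁ ⊔ m₂`-measurable sets. -/
theorem setIntegral_eq_of_forall_inter {m₁ m₂ : MeasurableSpace Ω} (h₁ : m₁ ≤ mΩ) (h₂ : m₂ ≤ mΩ)
    {f g : Ω → ℝ} (hf : Integrable f P) (hg : Integrable g P)
    (h : ∀ s t, MeasurableSet[m₁] s → MeasurableSet[m₂] t →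
      ∫ ω in s ∩ t, f ω ∂P = ∫ ω in s ∩ t, g ω ∂P)
    {u : Set Ω} (hu : MeasurableSet[m₁ ⊔ m₂] u) :
    ∫ ω in u, f ω ∂P = ∫ ω in u, g ω ∂P := by
  have hle : m₁ ⊔ m₂ ≤ mΩ := sup_le h₁ h₂
  induction u, hu using MeasurableSpace.induction_on_inter
    (MeasurableSpace.sup_eq_generateFrom_inter m₁ m₂)
    (isPiSystem_inter_measurableSet m₁ m₂) with
  | empty => simp
  | basic u hu =>
    obtain ⟨s, t, hs, ht, rfl⟩ := hu
    exact h s t hs ht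
  | compl u hu ih =>
    have huniv := h Set.univ Set.univ MeasurableSet.univ MeasurableSet.univ
    simp only [Set.inter_self, setIntegral_univ] at huniv
    have hf' := integral_add_compl (hle u hu) hf
    have hg' := integral_add_compl (hle u hu) hg
    linarith
  | iUnion v hd hv ih =>
    rw [integral_iUnion (fun i => hle _ (hv i)) hd hf.integrableOn,
      integral_iUnion (fun i => hle _ (hv i)) hd hg.integrableOn]
    simp_rw [ih]

/-- The conditional probabilities of the events of `mA` given `mE` are already given by `mC`. -/
def CondProbEq (P : Measure Ω) (mA mC mE : MeasurableSpace Ω) : Prop :=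
  ∀ s, MeasurableSet[mA] s →
    P[s.indicator fun _ => (1 : ℝ) | mE] =ᵐ[P] P[s.indicator fun _ => (1 : ℝ) | mC]

/-- Factorization of the conditional probabilities given `mC` of the events of `mA` and `mD`. -/
def CondProbFactors (P : Measure Ω) (mA mD mC : MeasurableSpace Ω) : Prop :=
  ∀ s t, MeasurableSet[mA] s → MeasurableSet[mD] t →
    P[(s.indicator fun _ => (1 : ℝ)) * (t.indicator fun _ => (1 : ℝ)) | mC] =ᵐ[P]
      P[s.indicator fun _ => (1 : ℝ) | mC] * P[t.indicator fun _ => (1 : ℝ) | mC]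

theorem CondProbFactors.symm (h : CondProbFactors P mA mD mC) : CondProbFactors P mD mA mC := by
  intro t s ht hs
  rw [mul_comm, mul_comm (P[_ | mC])]
  exact h s t hs ht

theorem CondProbEq.mono_left (h : CondProbEq P mA mC mE) (hA : mA' ≤ mA) :
    CondProbEq P mA' mC mE :=
  fun s hs => h s (hA s hs)

theorem CondProbEq.trans (h : CondProbEq P mA mC mD) (h' : CondProbEq P mA mD mE) :
    CondProbEq P mA mC mE :=
  fun s hs => (h' s hs).trans (h s hs)

variable [IsProbabilityMeasure P]

theorem CondProbEq.mono_right (h : CondProbEq P mA mC mE) (hC : mC ≤ mE') (hE' : mE' ≤ mE)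
    (hE : mE ≤ mΩ) : CondProbEq P mA mC mE' := by
  intro s hs
  calc P[s.indicator fun _ => (1 : ℝ) | mE']
      =ᵐ[P] P[P[s.indicator fun _ => (1 : ℝ) | mE] | mE'] :=
        (condExp_condExp_of_le hE' hE).symm
    _ =ᵐ[P] P[P[s.indicator fun _ => (1 : ℝ) | mC] | mE'] := condExp_congr_ae (h s hs)
    _ = P[s.indicator fun _ => (1 : ℝ) | mC] :=
        condExp_of_stronglyMeasurable (hE'.trans hE)
          (stronglyMeasurable_condExp.mono hC) integrable_condExp

theorem CondProbEq.weakUnion (h : CondProbEq P mA mC mE) (hC : mC ≤ mC') (hC' : mC' ≤ mE)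
    (hE : mE ≤ mΩ) : CondProbEq P mA mC' mE :=
  fun s hs => (h s hs).trans (h.mono_right hC hC' hE s hs).symm

theorem CondProbEq.condProbFactors (h : CondProbEq P mA mC mE) (hA : mA ≤ mΩ) (hC : mC ≤ mE)
    (hD : mD ≤ mE) (hE : mE ≤ mΩ) : CondProbFactors P mA mD mC := by
  intro s t hs ht
  have hs_int : Integrable (s.indicator fun _ => (1 : ℝ)) P :=
    (integrable_const 1).indicator (hA s hs)
  have ht_meas : MeasurableSet t := hE t (hD t ht)
  have ht_int : Integrable (t.indicator fun _ => (1 : ℝ)) P :=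
    (integrable_const 1).indicator ht_meas
  have ht_sm : StronglyMeasurable[mE] (t.indicator fun _ => (1 : ℝ)) :=
    stronglyMeasurable_const.indicator (hD t ht)
  have hmul : ∀ f : Ω → ℝ, Integrable f P →
      Integrable (f * t.indicator fun _ => (1 : ℝ)) P := fun f hf => by
    rw [mul_indicator_one]
    exact hf.indicator ht_meas
  calc P[(s.indicator fun _ => (1 : ℝ)) * (t.indicator fun _ => (1 : ℝ)) | mC]
      =ᵐ[P] P[P[(s.indicator fun _ => (1 : ℝ)) * (t.indicator fun _ => (1 : ℝ)) | mE] | mC] :=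
        (condExp_condExp_of_le hC hE).symm
    _ =ᵐ[P] P[P[s.indicator fun _ => (1 : ℝ) | mE] * (t.indicator fun _ => (1 : ℝ)) | mC] :=
        condExp_congr_ae (condExp_mul_of_stronglyMeasurable_right ht_sm (hmul _ hs_int) hs_int)
    _ =ᵐ[P] P[P[s.indicator fun _ => (1 : ℝ) | mC] * (t.indicator fun _ => (1 : ℝ)) | mC] :=
        condExp_congr_ae ((h s hs).mul Filter.EventuallyEq.rfl)
    _ =ᵐ[P] P[s.indicator fun _ => (1 : ℝ) | mC] * P[t.indicator fun _ => (1 : ℝ) | mC] :=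
        condExp_mul_of_stronglyMeasurable_left stronglyMeasurable_condExp
          (hmul _ integrable_condExp) ht_int

theorem CondProbFactors.condProbEq (h : CondProbFactors P mA mD mC) (hA : mA ≤ mΩ)
    (hC : mC ≤ mΩ) (hD : mD ≤ mΩ) : CondProbEq P mA mC (mC ⊔ mD) := by
  intro s hs
  have hs_int : Integrable (s.indicator fun _ => (1 : ℝ)) P :=
    (integrable_const 1).indicator (hA s hs)
  have hsm : StronglyMeasurable[mC ⊔ mD] (P[s.indicator fun _ => (1 : ℝ) | mC]) :=
    stronglyMeasurable_condExp.mono le_sup_left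
  refine (ae_eq_condExp_of_forall_setIntegral_eq (sup_le hC hD) hs_int
    (fun _ _ _ => integrable_condExp.integrableOn) (fun u hu _ => ?_)
    hsm.aestronglyMeasurable).symm
  refine setIntegral_eq_of_forall_inter hC hD integrable_condExp hs_int (fun c t hc ht => ?_) hu
  have ht_int : Integrable (t.indicator fun _ => (1 : ℝ)) P :=
    (integrable_const 1).indicator (hD t ht)
  have hmul : ∀ f : Ω → ℝ, Integrable f P →
      Integrable (f * t.indicator fun _ => (1 : ℝ)) P := fun f hf => by
    rw [mul_indicator_one]
    exact hf.indicator (hD t ht)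
  have hset : ∀ f : Ω → ℝ, Integrable f P → ∫ ω in c ∩ t, f ω ∂P =
      ∫ ω in c, (P[f * t.indicator fun _ => (1 : ℝ) | mC]) ω ∂P := fun f hf => by
    rw [setIntegral_condExp hC (hmul f hf) hc, mul_indicator_one,
      setIntegral_indicator (hD t ht)]
  rw [hset _ integrable_condExp, hset _ hs_int]
  refine integral_congr_ae (ae_restrict_of_ae ?_)
  exact (condExp_mul_of_stronglyMeasurable_left stronglyMeasurable_condExp
    (hmul _ integrable_condExp) ht_int).trans (h s t hs ht).symm

theorem CondProbEq.symm (h : CondProbEq P mA mC mE) (hA : mA ≤ mΩ) (hC : mC ≤ mE)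
    (hE : mE ≤ mΩ) : CondProbEq P mE mC (mC ⊔ mA) :=
  (h.condProbFactors hA hC le_rfl hE).symm.condProbEq hE (hC.trans hE) hA

theorem condIndepRV_iff_condProbEq {α β γ : Type*} [MeasurableSpace α] [MeasurableSpace β]
    [MeasurableSpace γ] {S : Ω → α} {W : Ω → β} {Z : Ω → γ} (hS : Measurable S)
    (hW : Measurable W) (hZ : Measurable Z) :
    CondIndepRV P S W Z ↔ CondProbEq P (MeasurableSpace.comap S inferInstance)
      (MeasurableSpace.comap Z inferInstance)
      (MeasurableSpace.comap Z inferInstance ⊔ MeasurableSpace.comap W inferInstance) := by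
  have hfac : CondIndepRV P S W Z ↔ CondProbFactors P (MeasurableSpace.comap S inferInstance)
      (MeasurableSpace.comap W inferInstance) (MeasurableSpace.comap Z inferInstance) := by
    constructor
    · rintro h _ _ ⟨A, hA, rfl⟩ ⟨B, hB, rfl⟩
      exact h A B hA hB
    · intro h A B hA hB
      exact h _ _ ⟨A, hA, rfl⟩ ⟨B, hB, rfl⟩
  rw [hfac]
  exact ⟨fun h => h.condProbEq hS.comap_le hZ.comap_le hW.comap_le,
    fun h => h.condProbFactors hS.comap_le le_sup_left le_sup_right
      (sup_le hZ.comap_le hW.comap_le)⟩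

end ConditionalIndependence

theorem comap_prodMk_eq_sup {Ω α β : Type*} [mα : MeasurableSpace α] [mβ : MeasurableSpace β]
    (f : Ω → α) (g : Ω → β) :
    MeasurableSpace.comap (fun ω => (f ω, g ω)) Prod.instMeasurableSpace =
      MeasurableSpace.comap f mα ⊔ MeasurableSpace.comap g mβ :=
  MeasurableSpace.comap_prodMk f g

section Coordinates

variable {Ω ι : Type*} {𝒳 : ι → Type*} [∀ i, MeasurableSpace (𝒳 i)]

/-- The σ-algebra generated by the coordinates `X i` with `p i`. -/
@[reducible]
def coordSigma (X : Ω → ∀ i, 𝒳 i) (p : ι → Prop) : MeasurableSpace Ω :=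
  ⨆ (i) (_ : p i), MeasurableSpace.comap (fun ω => X ω i) inferInstance

theorem comap_restrict_eq_coordSigma (X : Ω → ∀ i, 𝒳 i) (p : ι → Prop) :
    MeasurableSpace.comap (fun ω (j : {k // p k}) => X ω j.1) inferInstance = coordSigma X p := by
  simp_rw [coordSigma, MeasurableSpace.pi, MeasurableSpace.comap_iSup, MeasurableSpace.comap_comp,
    iSup_subtype']
  rfl

theorem comap_eq_coordSigma (X : Ω → ∀ i, 𝒳 i) :
    MeasurableSpace.comap X inferInstance = coordSigma X fun _ => True := by
  simp_rw [coordSigma, MeasurableSpace.pi, MeasurableSpace.comap_iSup, MeasurableSpace.comap_comp,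
    iSup_true]
  rfl

theorem coordSigma_mono (X : Ω → ∀ i, 𝒳 i) {p q : ι → Prop} (h : ∀ i, p i → q i) :
    coordSigma X p ≤ coordSigma X q :=
  biSup_mono h

theorem comap_coord_le_coordSigma (X : Ω → ∀ i, 𝒳 i) {p : ι → Prop} {i : ι} (h : p i) :
    MeasurableSpace.comap (fun ω => X ω i) inferInstance ≤ coordSigma X p :=
  le_iSup₂_of_le i h le_rfl

theorem coordSigma_le_sup_comap_coord (X : Ω → ∀ i, 𝒳 i) {p q : ι → Prop} {i : ι}
    (h : ∀ j, q j → p j ∨ j = i) :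
    coordSigma X q ≤ coordSigma X p ⊔ MeasurableSpace.comap (fun ω => X ω i) inferInstance := by
  refine iSup₂_le fun j hj => ?_
  rcases h j hj with hp | rfl
  · exact le_sup_of_le_left (comap_coord_le_coordSigma X hp)
  · exact le_sup_right

theorem coordSigma_le [mΩ : MeasurableSpace Ω] {X : Ω → ∀ i, 𝒳 i} (hX : Measurable X)
    (p : ι → Prop) : coordSigma X p ≤ mΩ :=
  iSup₂_le fun i _ => ((measurable_pi_apply i).comp hX).comap_le

end Coordinates

section SortedDAG

variable {Ω : Type*} {n : ℕ}
  {E : Fin n → Fin n → Prop} {𝒳 𝒴 : Fin n → Type*} [∀ i, MeasurableSpace (𝒳 i)]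
  [∀ i, MeasurableSpace (𝒴 i)] {X : Ω → ∀ i, 𝒳 i} {Y : Ω → ∀ i, 𝒴 i}

/-- The σ-algebra generated by the first `k` coordinates of `X` and the first `l` of `Y`. -/
@[reducible]
def pastSigma (X : Ω → ∀ i, 𝒳 i) (Y : Ω → ∀ i, 𝒴 i) (k l : ℕ) : MeasurableSpace Ω :=
  coordSigma X (fun j => (j : ℕ) < k) ⊔ coordSigma Y (fun j => (j : ℕ) < l)

/-- The σ-algebra generated by `X i` and the coordinates of `X` and `Y` at the parents of `i`. -/
@[reducible]
def parentSigma (E : Fin n → Fin n → Prop) (X : Ω → ∀ i, 𝒳 i) (Y : Ω → ∀ i, 𝒴 i) (i : Fin n) :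
    MeasurableSpace Ω :=
  MeasurableSpace.comap (fun ω => X ω i) inferInstance ⊔
    (coordSigma X (fun j => E j i) ⊔ coordSigma Y (fun j => E j i))

theorem pastSigma_mono (X : Ω → ∀ i, 𝒳 i) (Y : Ω → ∀ i, 𝒴 i) {k k' l l' : ℕ} (hk : k ≤ k')
    (hl : l ≤ l') : pastSigma X Y k l ≤ pastSigma X Y k' l' :=
  sup_le_sup (coordSigma_mono X fun _ h => h.trans_le hk)
    (coordSigma_mono Y fun _ h => h.trans_le hl)

theorem comap_left_le_pastSigma (X : Ω → ∀ i, 𝒳 i) (Y : Ω → ∀ i, 𝒴 i) {k l : ℕ} {i : Fin n}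
    (h : (i : ℕ) < k) :
    MeasurableSpace.comap (fun ω => X ω i) inferInstance ≤ pastSigma X Y k l :=
  le_sup_of_le_left (comap_coord_le_coordSigma X h)

theorem comap_right_le_pastSigma (X : Ω → ∀ i, 𝒳 i) (Y : Ω → ∀ i, 𝒴 i) {k l : ℕ} {i : Fin n}
    (h : (i : ℕ) < l) :
    MeasurableSpace.comap (fun ω => Y ω i) inferInstance ≤ pastSigma X Y k l :=
  le_sup_of_le_right (comap_coord_le_coordSigma Y h)

theorem pastSigma_succ_left_le (X : Ω → ∀ i, 𝒳 i) (Y : Ω → ∀ i, 𝒴 i) (i : Fin n) (l : ℕ) :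
    pastSigma X Y (i + 1) l ≤
      pastSigma X Y i l ⊔ MeasurableSpace.comap (fun ω => X ω i) inferInstance :=
  sup_le ((coordSigma_le_sup_comap_coord X fun j hj => by
      rw [Fin.ext_iff]; omega).trans (sup_le_sup_right le_sup_left _))
    (le_sup_of_le_left le_sup_right)

theorem pastSigma_succ_right_le (X : Ω → ∀ i, 𝒳 i) (Y : Ω → ∀ i, 𝒴 i) (k : ℕ) (i : Fin n) :
    pastSigma X Y k (i + 1) ≤
      pastSigma X Y k i ⊔ MeasurableSpace.comap (fun ω => Y ω i) inferInstance :=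
  sup_le (le_sup_of_le_left le_sup_left)
    ((coordSigma_le_sup_comap_coord Y fun j hj => by
      rw [Fin.ext_iff]; omega).trans (sup_le_sup_right le_sup_right _))

theorem coordSigma_parents_le_pastSigma (hE : ∀ i j, E i j → i < j) (X : Ω → ∀ i, 𝒳 i)
    (Y : Ω → ∀ i, 𝒴 i) (i : Fin n) (l : ℕ) :
    coordSigma X (fun j => E j i) ≤ pastSigma X Y i l :=
  le_sup_of_le_left (coordSigma_mono X fun j h => hE j i h)

theorem parentSigma_le_pastSigma (hE : ∀ i j, E i j → i < j) (X : Ω → ∀ i, 𝒳 i)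
    (Y : Ω → ∀ i, 𝒴 i) (i : Fin n) : parentSigma E X Y i ≤ pastSigma X Y (i + 1) i :=
  sup_le (comap_left_le_pastSigma X Y (Nat.lt_succ_self _))
    (sup_le_sup (coordSigma_mono X fun j h => Nat.lt_succ_of_lt (hE j i h))
      (coordSigma_mono Y fun j h => hE j i h))

variable [mΩ : MeasurableSpace Ω] {P : Measure Ω} [IsProbabilityMeasure P]

theorem pastSigma_le (hX : Measurable X) (hY : Measurable Y) (k l : ℕ) : pastSigma X Y k l ≤ mΩ :=
  sup_le (coordSigma_le hX _) (coordSigma_le hY _)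

theorem condProbEq_left_of_forall_right (hE : ∀ i j, E i j → i < j) (hX : Measurable X)
    (hY : Measurable Y)
    (hμ : ∀ i, CondProbEq P (MeasurableSpace.comap (fun ω => X ω i) inferInstance)
      (coordSigma X fun j => E j i) (pastSigma X Y i 0))
    (h : ∀ i, CondProbEq P (MeasurableSpace.comap (fun ω => Y ω i) inferInstance)
      (parentSigma E X Y i) (pastSigma X Y n i)) (i : Fin n) :
    CondProbEq P (MeasurableSpace.comap (fun ω => X ω i) inferInstance)
      (coordSigma X fun j => E j i) (pastSigma X Y i i) := by
  suffices ∀ l ≤ (i : ℕ), CondProbEq P (MeasurableSpace.comap (fun ω => X ω i) inferInstance)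
      (coordSigma X fun j => E j i) (pastSigma X Y i l) from this i le_rfl
  intro l hl
  induction l with
  | zero => exact hμ i
  | succ l ih =>
    let k : Fin n := ⟨l, by omega⟩
    have hle := pastSigma_le hX hY
    have hY_le := ((measurable_pi_apply k).comp hY).comap_le
    have hY_past : CondProbEq P (MeasurableSpace.comap (fun ω => Y ω k) inferInstance)
        (pastSigma X Y i l) (pastSigma X Y n l) :=
      (h k).weakUnion ((parentSigma_le_pastSigma hE X Y k).trans (pastSigma_mono X Y hl le_rfl))
        (pastSigma_mono X Y i.2.le le_rfl) (hle n l)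
    have hX_past := (hY_past.symm hY_le (pastSigma_mono X Y i.2.le le_rfl) (hle n l)).mono_left
      (comap_left_le_pastSigma X Y i.2)
    exact ((ih (Nat.le_of_succ_le hl)).trans hX_past).mono_right
      (coordSigma_parents_le_pastSigma hE X Y i _) (pastSigma_succ_right_le X Y i k)
      (sup_le (hle i l) hY_le)

theorem condProbEq_right_of_forall_left (hE : ∀ i j, E i j → i < j) (hX : Measurable X)
    (hY : Measurable Y)
    (hl : ∀ i, CondProbEq P (MeasurableSpace.comap (fun ω => X ω i) inferInstance)
      (coordSigma X fun j => E j i) (pastSigma X Y i i)) (i : Fin n)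
    (hr : CondProbEq P (MeasurableSpace.comap (fun ω => Y ω i) inferInstance)
      (parentSigma E X Y i) (pastSigma X Y (i + 1) i)) :
    CondProbEq P (MeasurableSpace.comap (fun ω => Y ω i) inferInstance)
      (parentSigma E X Y i) (pastSigma X Y n i) := by
  suffices ∀ k, (i : ℕ) + 1 ≤ k → k ≤ n →
      CondProbEq P (MeasurableSpace.comap (fun ω => Y ω i) inferInstance)
        (parentSigma E X Y i) (pastSigma X Y k i) from this n i.2 le_rfl
  intro k hik
  induction k, hik using Nat.le_induction with
  | base => exact fun _ => hr
  | succ k hik ih =>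
    intro hk
    let j : Fin n := ⟨k, hk⟩
    have hle := pastSigma_le hX hY
    have hX_le := ((measurable_pi_apply j).comp hX).comap_le
    have hik' : (i : ℕ) ≤ k := Nat.le_of_succ_le hik
    have hX_past : CondProbEq P (MeasurableSpace.comap (fun ω => X ω j) inferInstance)
        (pastSigma X Y k i) (pastSigma X Y k k) :=
      (hl j).weakUnion (coordSigma_parents_le_pastSigma hE X Y j i)
        (pastSigma_mono X Y le_rfl hik') (hle k k)
    have hY_past := (hX_past.symm hX_le (pastSigma_mono X Y le_rfl hik') (hle k k)).mono_left
      (comap_right_le_pastSigma X Y hik)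
    exact ((ih (Nat.le_of_succ_le hk)).trans hY_past).mono_right
      ((parentSigma_le_pastSigma hE X Y i).trans
        (pastSigma_mono X Y (Nat.le_succ_of_le hik) le_rfl))
      (pastSigma_succ_left_le X Y j i) (sup_le (hle k i) hX_le)

end SortedDAG

/-- For a sorted DAG `G`, a `G`-compatible `μ`, a coupling `π` of `μ` and
`ν` and `(X, Y) ~ π`, condition (ii) `Y_i ⫫_(X_i, X_pa_i, Y_pa_i) (X, Y_(1:i-1))` for all `i`
is equivalent to condition (iii) `X_i ⫫_(X_pa_i) (X_(1:i-1), Y_(1:i-1))` and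
`Y_i ⫫_(X_i, X_pa_i, Y_pa_i) (X_(1:i), Y_(1:i-1))` for all `i`. -/
theorem condIndep_ii_iff_iii {n : ℕ} (E : Fin n → Fin n → Prop)
    (hE : ∀ i j, E i j → i < j) (𝒳 𝒴 : Fin n → Type)
    [∀ i, TopologicalSpace (𝒳 i)] [∀ i, PolishSpace (𝒳 i)]
    [∀ i, MeasurableSpace (𝒳 i)] [∀ i, BorelSpace (𝒳 i)] [∀ i, Nonempty (𝒳 i)]
    [∀ i, TopologicalSpace (𝒴 i)] [∀ i, PolishSpace (𝒴 i)]
    [∀ i, MeasurableSpace (𝒴 i)] [∀ i, BorelSpace (𝒴 i)] [∀ i, Nonempty (𝒴 i)]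
    (μ : Measure (∀ i, 𝒳 i)) (ν : Measure (∀ i, 𝒴 i))
    [IsProbabilityMeasure μ] [IsProbabilityMeasure ν]
    (hμ : IsGComp E 𝒳 μ)
    (π : Measure ((∀ i, 𝒳 i) × (∀ i, 𝒴 i))) [IsProbabilityMeasure π]
    (hπ : IsCoupling μ ν π)
    (Ω : Type) (mΩ : MeasurableSpace Ω) (P : Measure Ω) [IsProbabilityMeasure P]
    (X : Ω → ∀ i, 𝒳 i) (Y : Ω → ∀ i, 𝒴 i) (hX : Measurable X) (hY : Measurable Y)
    (hlaw : P.map (fun ω => (X ω, Y ω)) = π) :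
    (∀ i : Fin n,
      CondIndepRV P (fun ω => Y ω i)
        (fun ω => (X ω, fun j : {k : Fin n // (k : ℕ) < (i : ℕ)} => Y ω j.1))
        (fun ω => (X ω i, (fun j : {k : Fin n // E k i} => X ω j.1),
          (fun j : {k : Fin n // E k i} => Y ω j.1))))
    ↔
    (∀ i : Fin n,
      CondIndepRV P (fun ω => X ω i)
        (fun ω => ((fun j : {k : Fin n // (k : ℕ) < (i : ℕ)} => X ω j.1),
          (fun j : {k : Fin n // (k : ℕ) < (i : ℕ)} => Y ω j.1)))
        (fun ω (j : {k : Fin n // E k i}) => X ω j.1) ∧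
      CondIndepRV P (fun ω => Y ω i)
        (fun ω => ((fun j : {k : Fin n // (k : ℕ) ≤ (i : ℕ)} => X ω j.1),
          (fun j : {k : Fin n // (k : ℕ) < (i : ℕ)} => Y ω j.1)))
        (fun ω => (X ω i, (fun j : {k : Fin n // E k i} => X ω j.1),
          (fun j : {k : Fin n // E k i} => Y ω j.1)))) := by
  have hXi : ∀ i, Measurable fun ω => X ω i := fun i => (measurable_pi_apply i).comp hX
  have hle : ∀ i : Fin n, (fun j : Fin n => (j : ℕ) ≤ (i : ℕ)) =
      fun j : Fin n => (j : ℕ) < (i : ℕ) + 1 :=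
    fun i => funext fun j => propext Nat.lt_succ_iff.symm
  have htrue : (fun _ : Fin n => True) = fun j : Fin n => (j : ℕ) < n :=
    funext fun j => propext (iff_of_true trivial j.2)
  have hii : ∀ i : Fin n, CondIndepRV P (fun ω => Y ω i)
        (fun ω => (X ω, fun j : {k : Fin n // (k : ℕ) < (i : ℕ)} => Y ω j.1))
        (fun ω => (X ω i, (fun j : {k : Fin n // E k i} => X ω j.1),
          (fun j : {k : Fin n // E k i} => Y ω j.1))) ↔
      CondProbEq P (MeasurableSpace.comap (fun ω => Y ω i) inferInstance)
        (parentSigma E X Y i) (pastSigma X Y n i) := fun i => by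
    rw [condIndepRV_iff_condProbEq (by fun_prop) (by fun_prop) (by fun_prop)]
    simp only [inferInstance, comap_prodMk_eq_sup, comap_restrict_eq_coordSigma,
      comap_eq_coordSigma X, htrue]
    rw [sup_eq_right.2 ((parentSigma_le_pastSigma hE X Y i).trans (pastSigma_mono X Y i.2 le_rfl))]
  have hiii : ∀ i : Fin n, CondIndepRV P (fun ω => Y ω i)
        (fun ω => ((fun j : {k : Fin n // (k : ℕ) ≤ (i : ℕ)} => X ω j.1),
          (fun j : {k : Fin n // (k : ℕ) < (i : ℕ)} => Y ω j.1)))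
        (fun ω => (X ω i, (fun j : {k : Fin n // E k i} => X ω j.1),
          (fun j : {k : Fin n // E k i} => Y ω j.1))) ↔
      CondProbEq P (MeasurableSpace.comap (fun ω => Y ω i) inferInstance)
        (parentSigma E X Y i) (pastSigma X Y (i + 1) i) := fun i => by
    rw [condIndepRV_iff_condProbEq (by fun_prop) (by fun_prop) (by fun_prop)]
    simp only [inferInstance, comap_prodMk_eq_sup, comap_restrict_eq_coordSigma, hle]
    rw [sup_eq_right.2 (parentSigma_le_pastSigma hE X Y i)]
  have hiii_left : ∀ i : Fin n, CondIndepRV P (fun ω => X ω i)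
        (fun ω => ((fun j : {k : Fin n // (k : ℕ) < (i : ℕ)} => X ω j.1),
          (fun j : {k : Fin n // (k : ℕ) < (i : ℕ)} => Y ω j.1)))
        (fun ω (j : {k : Fin n // E k i}) => X ω j.1) ↔
      CondProbEq P (MeasurableSpace.comap (fun ω => X ω i) inferInstance)
        (coordSigma X fun j => E j i) (pastSigma X Y i i) := fun i => by
    rw [condIndepRV_iff_condProbEq (by fun_prop) (by fun_prop) (by fun_prop)]
    simp only [inferInstance, comap_prodMk_eq_sup, comap_restrict_eq_coordSigma]
    rw [sup_eq_right.2 (coordSigma_parents_le_pastSigma hE X Y i i)]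
  have hmap : P.map X = μ := by
    rw [← hπ.1, ← hlaw, Measure.map_map measurable_fst (hX.prodMk hY)]
    rfl
  have hcomp : ∀ i, CondProbEq P (MeasurableSpace.comap (fun ω => X ω i) inferInstance)
      (coordSigma X fun j => E j i) (pastSigma X Y i 0) := fun i => by
    have hpast : pastSigma X Y i 0 = coordSigma X fun j => (j : ℕ) < i := by
      simp [pastSigma, coordSigma]
    have hpa : coordSigma X (fun j => E j i) ≤ coordSigma X fun j => (j : ℕ) < i :=
      coordSigma_mono X fun j h => hE j i h
    rw [hpast]
    rcases Nat.eq_zero_or_pos (i : ℕ) with hi | hi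
    · have hbot : coordSigma X (fun j => (j : ℕ) < i) = ⊥ := by simp [coordSigma, hi]
      rw [hbot] at hpa ⊢
      rw [le_bot_iff.1 hpa]
      exact fun _ _ => Filter.EventuallyEq.rfl
    · have h := (condIndepRV_iff_condProbEq (hXi i) (by fun_prop) (by fun_prop)).1
        (hμ Ω mΩ P inferInstance X hX hmap i hi)
      simp only [inferInstance, comap_restrict_eq_coordSigma] at h
      rwa [sup_eq_right.2 hpa] at h
  simp only [hii, hiii, hiii_left]
  constructor
  · exact fun h i => ⟨condProbEq_left_of_forall_right hE hX hY hcomp h i,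
      (h i).mono_right (parentSigma_le_pastSigma hE X Y i) (pastSigma_mono X Y i.2 le_rfl)
        (pastSigma_le hX hY n i)⟩
  · exact fun h i => condProbEq_right_of_forall_left hE hX hY (fun j => (h j).1) i (h i).2
end

section
/- Let G be a sorted DAG on {1,…,n}, X = X_1×…×X_n and Y = Y_1×…×Y_n products of nonempty Polish spaces, μ a G-compatible Borel probability measure on X, ν a Borel probability measure on Y, and π a coupling of μ and ν with (X,Y) ~ π. Then the following are equivalent: (iii) X_i ⫫_{X_{pa_i}} (X_{1:i-1}, Y_{1:i-1}) and Y_i ⫫_{(X_i, X_{pa_i}, Y_{pa_i})} (X_{1:i}, Y_{1:i-1}) for all i = 1,…,n; (iv) π is jointly G-compatible, i.e. π(dx_1,dy_1,…,dx_n,dy_n) = ⨂_{i=1}^n π(dx_i, dy_i | x_{pa_i}, y_{pa_i}), and moreover π(dx_i | x_{pa_i}, y_{pa_i}) = μ(dx_i | x_{pa_i}) for all i = 1,…,n and π-almost all (x,y). -/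
open MeasureTheory ProbabilityTheory
open scoped ENNReal

section SigmaAlgebra

variable {Ω : Type*} {m₁ m₁' m₂ m₂' m m' mΩ : MeasurableSpace Ω} {P : Measure Ω}

/-- The σ-algebras `m₁` and `m₂` are conditionally independent given `m` under `P`, stated through
conditional probabilities. -/
def CondIndepSigma {Ω : Type*} {mΩ : MeasurableSpace Ω} (P : Measure Ω)
    (m₁ m₂ m : MeasurableSpace Ω) : Prop :=
  ∀ s t, MeasurableSet[m₁] s → MeasurableSet[m₂] t →
    P[s.indicator (fun _ => (1 : ℝ)) * t.indicator (fun _ => (1 : ℝ)) | m] =ᵐ[P]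
      P[s.indicator (fun _ => (1 : ℝ)) | m] * P[t.indicator (fun _ => (1 : ℝ)) | m]

lemma integrable_indicator_one [IsProbabilityMeasure P] {s : Set Ω} (hs : MeasurableSet s) :
    Integrable (s.indicator fun _ => (1 : ℝ)) P :=
  (integrable_const _).indicator hs

lemma integrable_indicator_one_mul {s : Set Ω} (hs : MeasurableSet s) {f : Ω → ℝ}
    (hf : Integrable f P) : Integrable (s.indicator (fun _ => (1 : ℝ)) * f) P := by
  have : s.indicator (fun _ => (1 : ℝ)) * f = s.indicator f := by
    ext ω
    by_cases h : ω ∈ s <;> simp [h]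
  rw [this]
  exact hf.indicator hs

lemma setIntegral_indicator_one_mul {s d : Set Ω} (hs : MeasurableSet s) (f : Ω → ℝ) :
    ∫ ω in d, (s.indicator (fun _ => (1 : ℝ)) * f) ω ∂P = ∫ ω in s ∩ d, f ω ∂P := by
  have : s.indicator (fun _ => (1 : ℝ)) * f = s.indicator f := by
    ext ω
    by_cases h : ω ∈ s <;> simp [h]
  rw [this, setIntegral_indicator hs, Set.inter_comm]

lemma condExp_indicator_one_mul_condExp [IsProbabilityMeasure P] {s : Set Ω}
    (hs : MeasurableSet s) (f : Ω → ℝ) :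
    P[s.indicator (fun _ => (1 : ℝ)) * P[f | m] | m] =ᵐ[P]
      P[s.indicator (fun _ => (1 : ℝ)) | m] * P[f | m] :=
  condExp_mul_of_stronglyMeasurable_right stronglyMeasurable_condExp
    (integrable_indicator_one_mul hs integrable_condExp) (integrable_indicator_one hs)

/-- A set integral identity on the generators `s ∩ d` of `m₁ ⊔ m` holds on all of `m₁ ⊔ m`. -/
lemma setIntegral_eq_of_inter (hm₁ : m₁ ≤ mΩ) (hm : m ≤ mΩ)
    {f g : Ω → ℝ} (hf : Integrable f P) (hg : Integrable g P)
    (h : ∀ s d, MeasurableSet[m₁] s → MeasurableSet[m] d →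
      ∫ ω in s ∩ d, f ω ∂P = ∫ ω in s ∩ d, g ω ∂P)
    {C : Set Ω} (hC : MeasurableSet[m₁ ⊔ m] C) :
    ∫ ω in C, f ω ∂P = ∫ ω in C, g ω ∂P := by
  have hgen : m₁ ⊔ m = MeasurableSpace.generateFrom
      {u | ∃ s d, MeasurableSet[m₁] s ∧ MeasurableSet[m] d ∧ u = s ∩ d} := by
    apply le_antisymm
    · refine sup_le (fun s hs => ?_) (fun d hd => ?_)
      · exact MeasurableSpace.measurableSet_generateFrom
          ⟨s, Set.univ, hs, MeasurableSet.univ, by simp⟩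
      · exact MeasurableSpace.measurableSet_generateFrom
          ⟨Set.univ, d, MeasurableSet.univ, hd, by simp⟩
    · refine MeasurableSpace.generateFrom_le ?_
      rintro u ⟨s, d, hs, hd, rfl⟩
      exact MeasurableSet.inter (le_sup_left (a := m₁) (b := m) s hs)
        (le_sup_right (a := m₁) (b := m) d hd)
  have hpi : IsPiSystem {u | ∃ s d, MeasurableSet[m₁] s ∧ MeasurableSet[m] d ∧ u = s ∩ d} := by
    rintro _ ⟨s, d, hs, hd, rfl⟩ _ ⟨s', d', hs', hd', rfl⟩ _
    exact ⟨s ∩ s', d ∩ d', hs.inter hs', hd.inter hd', Set.inter_inter_inter_comm _ _ _ _⟩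
  have huniv : ∫ ω, f ω ∂P = ∫ ω, g ω ∂P := by
    simpa using h Set.univ Set.univ MeasurableSet.univ MeasurableSet.univ
  have hle : m₁ ⊔ m ≤ mΩ := sup_le hm₁ hm
  induction C, hC using MeasurableSpace.induction_on_inter hgen hpi with
  | empty => simp
  | basic u hu =>
    obtain ⟨s, d, hs, hd, rfl⟩ := hu
    exact h s d hs hd
  | compl u hu ih =>
    have h1 := integral_add_compl (hle u hu) hf
    have h2 := integral_add_compl (hle u hu) hg
    linarith
  | iUnion u hd hu ih =>
    rw [integral_iUnion (fun i => hle _ (hu i)) hd hf.integrableOn,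
      integral_iUnion (fun i => hle _ (hu i)) hd hg.integrableOn]
    simp_rw [ih]

/-- Conditional independence means that `m₁` does not help to predict `m₂` beyond `m`. -/
lemma condIndepSigma_iff [IsProbabilityMeasure P] (hm₁ : m₁ ≤ mΩ) (hm₂ : m₂ ≤ mΩ)
    (hm : m ≤ mΩ) :
    CondIndepSigma P m₁ m₂ m ↔ ∀ t, MeasurableSet[m₂] t →
      P[t.indicator (fun _ => (1 : ℝ)) | m₁ ⊔ m] =ᵐ[P] P[t.indicator (fun _ => (1 : ℝ)) | m] := by
  have hsup : m₁ ⊔ m ≤ mΩ := sup_le hm₁ hm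
  refine ⟨fun h t ht => ?_, fun h s t hs ht => ?_⟩
  · have hti : Integrable (t.indicator fun _ => (1 : ℝ)) P := integrable_indicator_one (hm₂ t ht)
    have hmeas : StronglyMeasurable[m₁ ⊔ m] (P[t.indicator (fun _ => (1 : ℝ)) | m]) :=
      stronglyMeasurable_condExp.mono le_sup_right
    refine (ae_eq_condExp_of_forall_setIntegral_eq hsup hti
      (fun _ _ _ => integrable_condExp.integrableOn) (fun C hC _ => ?_)
      hmeas.aestronglyMeasurable).symm
    refine setIntegral_eq_of_inter hm₁ hm integrable_condExp hti (fun s d hs hd => ?_) hC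
    have hs' := hm₁ s hs
    rw [← setIntegral_indicator_one_mul hs', ← setIntegral_indicator_one_mul hs',
      ← setIntegral_condExp hm (integrable_indicator_one_mul hs' integrable_condExp) hd,
      ← setIntegral_condExp hm (integrable_indicator_one_mul hs' hti) hd]
    refine setIntegral_congr_ae (hm d hd) ?_
    filter_upwards [h s t hs ht, condExp_indicator_one_mul_condExp (P := P) (m := m) hs'
      (t.indicator fun _ => (1 : ℝ))] with ω h1 h2 _
    rw [h1, h2]
  · have hti : Integrable (t.indicator fun _ => (1 : ℝ)) P := integrable_indicator_one (hm₂ t ht)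
    have hs' := hm₁ s hs
    have hsm : StronglyMeasurable[m₁ ⊔ m] (s.indicator fun _ => (1 : ℝ)) :=
      stronglyMeasurable_const.indicator (le_sup_left (a := m₁) (b := m) s hs)
    refine (condExp_condExp_of_le le_sup_right hsup).symm.trans ?_
    refine Filter.EventuallyEq.trans (condExp_congr_ae ?_)
      (condExp_indicator_one_mul_condExp hs' _)
    refine (condExp_mul_of_stronglyMeasurable_left hsm
      (integrable_indicator_one_mul hs' hti) hti).trans ?_
    exact Filter.EventuallyEq.rfl.mul (h t ht)

namespace CondIndepSigma

lemma symm (h : CondIndepSigma P m₁ m₂ m) : CondIndepSigma P m₂ m₁ m := fun s t hs ht => by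
  rw [mul_comm, mul_comm (P[s.indicator _ | m])]
  exact h t s ht hs

lemma mono (h : CondIndepSigma P m₁ m₂ m) (h₁ : m₁' ≤ m₁) (h₂ : m₂' ≤ m₂) :
    CondIndepSigma P m₁' m₂' m := fun s t hs ht => h s t (h₁ s hs) (h₂ t ht)

lemma sup_left [IsProbabilityMeasure P] (h : CondIndepSigma P m₁ m₂ m) (hm₁ : m₁ ≤ mΩ)
    (hm₂ : m₂ ≤ mΩ) (hm : m ≤ mΩ) :
    CondIndepSigma P (m₁ ⊔ m) m₂ m := by
  rw [condIndepSigma_iff (sup_le hm₁ hm) hm₂ hm, sup_assoc, sup_idem]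
  exact (condIndepSigma_iff hm₁ hm₂ hm).1 h

/-- Weak union. -/
lemma weak_union [IsProbabilityMeasure P] (h : CondIndepSigma P m₁ m₂ m) (hm₁ : m₁ ≤ mΩ)
    (hm₂ : m₂ ≤ mΩ) (hm : m ≤ mΩ) (hm' : m' ≤ m₁ ⊔ m) : CondIndepSigma P m₁ m₂ (m ⊔ m') := by
  have hsup : m₁ ⊔ m ≤ mΩ := sup_le hm₁ hm
  have hm'' : m ⊔ m' ≤ m₁ ⊔ m := sup_le le_sup_right hm'
  rw [condIndepSigma_iff hm₁ hm₂ (hm''.trans hsup), ← sup_assoc, sup_eq_left.2 hm']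
  rw [condIndepSigma_iff hm₁ hm₂ hm] at h
  intro t ht
  refine (h t ht).trans ?_
  have h1 := condExp_condExp_of_le (μ := P) (f := t.indicator fun _ => (1 : ℝ)) hm'' hsup
  refine Filter.EventuallyEq.trans ?_ h1
  refine Filter.EventuallyEq.trans ?_ (condExp_congr_ae (h t ht)).symm
  rw [condExp_of_stronglyMeasurable (hm''.trans hsup)
    (stronglyMeasurable_condExp.mono le_sup_left) integrable_condExp]

lemma contraction [IsProbabilityMeasure P] (h : CondIndepSigma P m₁ m₂ m)
    (h' : CondIndepSigma P m₁' m₂ (m ⊔ m₁))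
    (hm₁ : m₁ ≤ mΩ) (hm₁' : m₁' ≤ mΩ) (hm₂ : m₂ ≤ mΩ) (hm : m ≤ mΩ) :
    CondIndepSigma P (m₁ ⊔ m₁') m₂ m := by
  rw [condIndepSigma_iff (sup_le hm₁ hm₁') hm₂ hm]
  rw [condIndepSigma_iff hm₁ hm₂ hm] at h
  rw [condIndepSigma_iff hm₁' hm₂ (sup_le hm hm₁)] at h'
  intro t ht
  have h1 := h' t ht
  rw [show m₁' ⊔ (m ⊔ m₁) = m₁ ⊔ m₁' ⊔ m by ac_rfl, sup_comm m m₁] at h1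
  exact h1.trans (h t ht)

end CondIndepSigma

lemma condIndepSigma_of_le [IsProbabilityMeasure P] (hm₁ : m₁ ≤ mΩ) (hm : m ≤ mΩ)
    (h : m₂ ≤ m) : CondIndepSigma P m₁ m₂ m := by
  refine CondIndepSigma.symm ?_
  rw [condIndepSigma_iff (h.trans hm) hm₁ hm, sup_eq_right.2 h]
  exact fun _ _ => Filter.EventuallyEq.rfl

/-- Conditional independence when the second σ-algebra contains the conditioning one. -/
lemma condIndepSigma_iff_of_le [IsProbabilityMeasure P] (hm₁ : m₁ ≤ mΩ) (hm₂ : m₂ ≤ mΩ)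
    (h : m ≤ m₂) :
    CondIndepSigma P m₁ m₂ m ↔ ∀ s, MeasurableSet[m₁] s →
      P[s.indicator (fun _ => (1 : ℝ)) | m₂] =ᵐ[P] P[s.indicator (fun _ => (1 : ℝ)) | m] := by
  have := condIndepSigma_iff (P := P) hm₂ hm₁ (h.trans hm₂)
  rw [sup_eq_left.2 h] at this
  rw [← this]
  exact ⟨CondIndepSigma.symm, CondIndepSigma.symm⟩

end SigmaAlgebra

lemma condIndepRV_iff_sigma {Ω α β γ : Type*} [MeasurableSpace Ω] [MeasurableSpace α]
    [MeasurableSpace β] [MeasurableSpace γ] {P : Measure Ω} {S : Ω → α} {W : Ω → β} {Z : Ω → γ} :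
    CondIndepRV P S W Z ↔ CondIndepSigma P (MeasurableSpace.comap S inferInstance)
      (MeasurableSpace.comap W inferInstance) (MeasurableSpace.comap Z inferInstance) := by
  constructor
  · rintro h _ _ ⟨A, hA, rfl⟩ ⟨B, hB, rfl⟩
    exact h A B hA hB
  · intro h A B hA hB
    exact h _ _ ⟨A, hA, rfl⟩ ⟨B, hB, rfl⟩

/-- Conditional expectations commute with a change of variables. -/
lemma condExp_map_comp {Ω Ω' : Type*} {mΩ : MeasurableSpace Ω} {m mΩ' : MeasurableSpace Ω'}
    {P : Measure Ω} [IsProbabilityMeasure P] {φ : Ω → Ω'} (hφ : Measurable φ)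
    (hm : m ≤ mΩ') {f : Ω' → ℝ} (hf : Integrable f (P.map φ)) :
    P[f ∘ φ | m.comap φ] =ᵐ[P] (P.map φ)[f | m] ∘ φ := by
  have := Measure.isProbabilityMeasure_map (μ := P) hφ.aemeasurable
  have hle : m.comap φ ≤ mΩ := (MeasurableSpace.comap_mono hm).trans hφ.comap_le
  have hint : Integrable ((P.map φ)[f | m] ∘ φ) P := integrable_condExp.comp_measurable hφ
  refine (ae_eq_condExp_of_forall_setIntegral_eq hle (hf.comp_measurable hφ)
    (fun _ _ _ => hint.integrableOn) ?_ ?_).symm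
  · rintro _ ⟨D, hD, rfl⟩ -
    have h1 := setIntegral_condExp hm hf hD
    rw [setIntegral_map (hm D hD) integrable_condExp.aestronglyMeasurable hφ.aemeasurable,
      setIntegral_map (hm D hD) hf.aestronglyMeasurable hφ.aemeasurable] at h1
    exact h1
  · exact (stronglyMeasurable_condExp.comp_measurable
      (Measurable.of_comap_le le_rfl)).aestronglyMeasurable

/-- Conditional independence only depends on the joint law. -/
lemma condIndepRV_map_iff {Ω Ω' α β γ : Type*} {mΩ : MeasurableSpace Ω}
    {mΩ' : MeasurableSpace Ω'} [MeasurableSpace α]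
    [MeasurableSpace β] [MeasurableSpace γ] {P : Measure Ω} [IsProbabilityMeasure P]
    {φ : Ω → Ω'} (hφ : Measurable φ) {S : Ω' → α} {W : Ω' → β} {Z : Ω' → γ}
    (hS : Measurable S) (hW : Measurable W) (hZ : Measurable Z) :
    CondIndepRV (P.map φ) S W Z ↔
      CondIndepRV P (fun ω => S (φ ω)) (fun ω => W (φ ω)) (fun ω => Z (φ ω)) := by
  have := Measure.isProbabilityMeasure_map (μ := P) hφ.aemeasurable
  refine forall₂_congr fun A B => forall₂_congr fun hA hB => ?_
  have hSi : Integrable (evtInd S A) (P.map φ) := integrable_indicator_one (hS hA)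
  have hWi : Integrable (evtInd W B) (P.map φ) := integrable_indicator_one (hW hB)
  have hSWi : Integrable (evtInd S A * evtInd W B) (P.map φ) :=
    integrable_indicator_one_mul (hS hA) hWi
  have e : MeasurableSpace.comap (fun ω => Z (φ ω)) inferInstance =
      (MeasurableSpace.comap Z inferInstance).comap φ := MeasurableSpace.comap_comp.symm
  rw [e]
  have h1 := condExp_map_comp hφ hZ.comap_le hSi
  have h2 := condExp_map_comp hφ hZ.comap_le hWi
  have h3 := condExp_map_comp hφ hZ.comap_le hSWi
  have hms : MeasurableSet {x | ((P.map φ)[evtInd S A * evtInd W B |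
      MeasurableSpace.comap Z inferInstance]) x =
      ((P.map φ)[evtInd S A | MeasurableSpace.comap Z inferInstance] *
      (P.map φ)[evtInd W B | MeasurableSpace.comap Z inferInstance]) x} :=
    measurableSet_eq_fun (stronglyMeasurable_condExp.measurable.mono hZ.comap_le le_rfl)
      ((stronglyMeasurable_condExp.mul stronglyMeasurable_condExp).measurable.mono
        hZ.comap_le le_rfl)
  rw [Filter.EventuallyEq, ae_map_iff hφ.aemeasurable hms]
  constructor <;> intro h
  · filter_upwards [h, h1, h2, h3] with ω h h1 h2 h3
    exact h3.trans (h.trans (congr_arg₂ (· * ·) h1.symm h2.symm))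
  · filter_upwards [h, h1, h2, h3] with ω h h1 h2 h3
    exact h3.symm.trans (h.trans (congr_arg₂ (· * ·) h1 h2))

/-- If `m ≤ q ≤ F`, then sampling `a` from `F` through `m` only, and then `b` through `q ⊔ a` only,
amounts to sampling `a ⊔ b` through `q` only, where `q` predicts `a` no better than `m` does. -/
lemma condIndepSigma_and_iff_sup {Ω : Type*} {a b F m q mΩ : MeasurableSpace Ω} {P : Measure Ω}
    [IsProbabilityMeasure P] (ha : a ≤ mΩ) (hb : b ≤ mΩ) (hF : F ≤ mΩ) (hmq : m ≤ q)
    (hqF : q ≤ F) :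
    CondIndepSigma P a F m ∧ CondIndepSigma P b (F ⊔ a) (q ⊔ a) ↔
      CondIndepSigma P (a ⊔ b) F q ∧ ∀ s, MeasurableSet[a] s →
        P[s.indicator (fun _ => (1 : ℝ)) | q] =ᵐ[P] P[s.indicator (fun _ => (1 : ℝ)) | m] := by
  have hq := hqF.trans hF
  have hm := hmq.trans hq
  constructor
  · rintro ⟨h1, h2⟩
    have h3 := (h1.symm.weak_union hF ha hm (hqF.trans le_sup_left)).symm
    rw [sup_eq_right.2 hmq] at h3
    refine ⟨h3.contraction (h2.mono le_rfl le_sup_left) ha hb hF hq, fun s hs => ?_⟩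
    exact ((condIndepSigma_iff_of_le ha hF hqF).1 h3 s hs).symm.trans
      ((condIndepSigma_iff_of_le ha hF (hmq.trans hqF)).1 h1 s hs)
  · rintro ⟨h1, h2⟩
    have hab := sup_le ha hb
    refine ⟨(condIndepSigma_iff_of_le ha hF (hmq.trans hqF)).2 fun s hs => ?_, ?_⟩
    · exact ((condIndepSigma_iff_of_le ha hF hqF).1 (h1.mono le_sup_left le_rfl) s hs).trans
        (h2 s hs)
    · have h3 := h1.weak_union hab hF hq (m' := a) (le_sup_left.trans le_sup_left)
      exact (h3.symm.sup_left hF hab (sup_le hq ha)).symm.mono le_sup_right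
        (sup_le le_sup_left (le_sup_right.trans le_sup_right))

/-- The conditional distribution given `W` only depends on `g ∘ W` if and only if the conditional
probabilities given `W` and given `g ∘ W` agree. -/
lemma condDistrib_ae_eq_comp_iff {Ω α β γ : Type*} {mΩ : MeasurableSpace Ω}
    [MeasurableSpace α] [StandardBorelSpace α] [Nonempty α] [MeasurableSpace β]
    [MeasurableSpace γ] {P : Measure Ω} [IsProbabilityMeasure P] {S : Ω → α} {W : Ω → β}
    {g : β → γ} (hS : Measurable S) (hW : Measurable W) (hg : Measurable g) :
    (∀ᵐ ω ∂P, condDistrib S W P (W ω) = condDistrib S (fun ω => g (W ω)) P (g (W ω))) ↔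
      ∀ s, MeasurableSet[MeasurableSpace.comap S inferInstance] s →
        P[s.indicator (fun _ => (1 : ℝ)) | MeasurableSpace.comap W inferInstance] =ᵐ[P]
        P[s.indicator (fun _ => (1 : ℝ)) |
          MeasurableSpace.comap (fun ω => g (W ω)) inferInstance] := by
  have hgW : Measurable fun ω => g (W ω) := hg.comp hW
  constructor
  · rintro h _ ⟨A, hA, rfl⟩
    refine (condDistrib_ae_eq_condExp hW hS hA).symm.trans
      (Filter.EventuallyEq.trans ?_ (condDistrib_ae_eq_condExp hgW hS hA))
    filter_upwards [h] with ω h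
    rw [h]
  · intro h
    have key : condDistrib S W P =ᵐ[P.map W]
        (condDistrib S (fun ω => g (W ω)) P).comap g hg := by
      refine condDistrib_ae_eq_of_measure_eq_compProd_of_measurable hW hS ?_
      have := Measure.isProbabilityMeasure_map (μ := P) (hW.prodMk hS).aemeasurable
      refine Measure.ext_prod fun {C A} hC hA => ?_
      rw [Measure.map_apply (hW.prodMk hS) (hC.prod hA), Measure.compProd_apply_prod hC hA,
        setLIntegral_map hC (Kernel.measurable_coe _ hA) hW, Set.mk_preimage_prod,
        ← setLIntegral_preimage_condDistrib hW hS.aemeasurable hA hC]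
      refine lintegral_congr_ae (ae_restrict_of_ae ?_)
      filter_upwards [condDistrib_ae_eq_condExp (μ := P) hW hS hA,
        condDistrib_ae_eq_condExp (μ := P) hgW hS hA, h _ ⟨A, hA, rfl⟩] with ω h1 h2 h3
      rw [Kernel.comap_apply]
      exact (measureReal_eq_measureReal_iff).1 (h1.trans (h3.trans h2.symm))
    filter_upwards [ae_of_ae_map hW.aemeasurable key] with ω h
    rw [h, Kernel.comap_apply]

lemma comap_pi_eq_iSup {Ω ι : Type*} {α : ι → Type*} [∀ j, MeasurableSpace (α j)]
    (f : ∀ j, Ω → α j) :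
    MeasurableSpace.comap (fun ω j => f j ω) inferInstance =
      ⨆ j, MeasurableSpace.comap (f j) inferInstance := by
  simp only [MeasurableSpace.pi, MeasurableSpace.comap_iSup, MeasurableSpace.comap_comp]
  rfl

section Product

variable {n : ℕ} {E : Fin n → Fin n → Prop} {𝒳 𝒴 : Fin n → Type}
  [∀ i, MeasurableSpace (𝒳 i)] [∀ i, MeasurableSpace (𝒴 i)]
  (π : Measure ((∀ i, 𝒳 i) × (∀ i, 𝒴 i))) [IsProbabilityMeasure π]

/-- On the canonical space, the two conditional independences at the vertex `i` together amount to
one for the pair, plus an equality of conditional distributions. -/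
lemma condIndepRV_and_iff (hE : ∀ i j, E i j → i < j) (i : Fin n)
    [StandardBorelSpace (𝒳 i)] [Nonempty (𝒳 i)] :
    (CondIndepRV π (fun z => z.1 i)
        (fun z => ((fun j : {k : Fin n // (k : ℕ) < (i : ℕ)} => z.1 j.1),
          (fun j : {k : Fin n // (k : ℕ) < (i : ℕ)} => z.2 j.1)))
        (fun z (j : {k : Fin n // E k i}) => z.1 j.1) ∧
      CondIndepRV π (fun z => z.2 i)
        (fun z => ((fun j : {k : Fin n // (k : ℕ) ≤ (i : ℕ)} => z.1 j.1),
          (fun j : {k : Fin n // (k : ℕ) < (i : ℕ)} => z.2 j.1)))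
        (fun z => (z.1 i, (fun j : {k : Fin n // E k i} => z.1 j.1),
          (fun j : {k : Fin n // E k i} => z.2 j.1))))
    ↔
    CondIndepRV π (fun z => (z.1 i, z.2 i))
        (fun z (j : {k : Fin n // (k : ℕ) < (i : ℕ)}) => (z.1 j.1, z.2 j.1))
        (fun z (j : {k : Fin n // E k i}) => (z.1 j.1, z.2 j.1)) ∧
      ∀ᵐ z ∂π,
        condDistrib (fun w : (∀ l, 𝒳 l) × (∀ l, 𝒴 l) => w.1 i)
          (fun w => ((fun j : {k : Fin n // E k i} => w.1 j.1),
            (fun j : {k : Fin n // E k i} => w.2 j.1))) π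
          ((fun j : {k : Fin n // E k i} => z.1 j.1),
            (fun j : {k : Fin n // E k i} => z.2 j.1))
        = condDistrib (fun w : (∀ l, 𝒳 l) × (∀ l, 𝒴 l) => w.1 i)
            (fun w (j : {k : Fin n // E k i}) => w.1 j.1) π
            (fun j : {k : Fin n // E k i} => z.1 j.1) := by
  have hlt : ∀ {k}, E k i → (k : ℕ) < (i : ℕ) := fun h => hE _ _ h
  let mx : Fin n → MeasurableSpace ((∀ i, 𝒳 i) × (∀ i, 𝒴 i)) :=
    fun k => MeasurableSpace.comap (fun z => z.1 k) inferInstance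
  let my : Fin n → MeasurableSpace ((∀ i, 𝒳 i) × (∀ i, 𝒴 i)) :=
    fun k => MeasurableSpace.comap (fun z => z.2 k) inferInstance
  have hmx : ∀ k, mx k ≤ Prod.instMeasurableSpace := fun k =>
    Measurable.comap_le (by fun_prop)
  have hmy : ∀ k, my k ≤ Prod.instMeasurableSpace := fun k =>
    Measurable.comap_le (by fun_prop)
  have hx : ∀ p : Fin n → Prop, MeasurableSpace.comap
      (fun (z : (∀ i, 𝒳 i) × (∀ i, 𝒴 i)) (j : {k : Fin n // p k}) => z.1 j.1) inferInstance =
      ⨆ j : {k : Fin n // p k}, mx j.1 := fun p =>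
    comap_pi_eq_iSup fun (j : {k : Fin n // p k}) (z : (∀ i, 𝒳 i) × (∀ i, 𝒴 i)) => z.1 j.1
  have hy : ∀ p : Fin n → Prop, MeasurableSpace.comap
      (fun (z : (∀ i, 𝒳 i) × (∀ i, 𝒴 i)) (j : {k : Fin n // p k}) => z.2 j.1) inferInstance =
      ⨆ j : {k : Fin n // p k}, my j.1 := fun p =>
    comap_pi_eq_iSup fun (j : {k : Fin n // p k}) (z : (∀ i, 𝒳 i) × (∀ i, 𝒴 i)) => z.2 j.1
  have hxy : ∀ p : Fin n → Prop, MeasurableSpace.comap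
      (fun (z : (∀ i, 𝒳 i) × (∀ i, 𝒴 i)) (j : {k : Fin n // p k}) => (z.1 j.1, z.2 j.1))
        inferInstance =
      (⨆ j : {k : Fin n // p k}, mx j.1) ⊔ ⨆ j : {k : Fin n // p k}, my j.1 := fun p => by
    rw [← iSup_sup_eq]
    refine (comap_pi_eq_iSup fun (j : {k : Fin n // p k})
      (z : (∀ i, 𝒳 i) × (∀ i, 𝒴 i)) => (z.1 j.1, z.2 j.1)).trans ?_
    exact iSup_congr fun j => MeasurableSpace.comap_prodMk _ _
  have hle : (⨆ j : {k : Fin n // (k : ℕ) ≤ (i : ℕ)}, mx j.1) =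
      (⨆ j : {k : Fin n // (k : ℕ) < (i : ℕ)}, mx j.1) ⊔ mx i := by
    apply le_antisymm
    · refine iSup_le fun ⟨j, hj⟩ => ?_
      rcases hj.lt_or_eq with h | h
      · exact (le_iSup (fun j : {k : Fin n // (k : ℕ) < (i : ℕ)} => mx j.1) ⟨j, h⟩).trans
          le_sup_left
      · obtain rfl : j = i := Fin.ext h
        exact le_sup_right
    · refine sup_le (iSup_le fun ⟨j, hj⟩ => ?_) ?_
      · exact le_iSup (fun j : {k : Fin n // (k : ℕ) ≤ (i : ℕ)} => mx j.1) ⟨j, hj.le⟩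
      · exact le_iSup (fun j : {k : Fin n // (k : ℕ) ≤ (i : ℕ)} => mx j.1) ⟨i, le_rfl⟩
  have hpa : ∀ m : Fin n → MeasurableSpace ((∀ i, 𝒳 i) × (∀ i, 𝒴 i)),
      (⨆ j : {k : Fin n // E k i}, m j.1) ≤ ⨆ j : {k : Fin n // (k : ℕ) < (i : ℕ)}, m j.1 :=
    fun m => iSup_le fun ⟨j, hj⟩ =>
      le_iSup (fun j : {k : Fin n // (k : ℕ) < (i : ℕ)} => m j.1) ⟨j, hlt hj⟩
  have hcore := condIndepSigma_and_iff_sup (P := π) (hmx i) (hmy i)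
    (sup_le (iSup_le fun j : {k : Fin n // (k : ℕ) < (i : ℕ)} => hmx j.1)
      (iSup_le fun j : {k : Fin n // (k : ℕ) < (i : ℕ)} => hmy j.1))
    (m := ⨆ j : {k : Fin n // E k i}, mx j.1)
    (q := (⨆ j : {k : Fin n // E k i}, mx j.1) ⊔ ⨆ j : {k : Fin n // E k i}, my j.1)
    le_sup_left (sup_le_sup (hpa mx) (hpa my))
  have hdist := condDistrib_ae_eq_comp_iff (P := π)
    (S := fun w : (∀ l, 𝒳 l) × (∀ l, 𝒴 l) => w.1 i)
    (W := fun w => ((fun j : {k : Fin n // E k i} => w.1 j.1),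
            (fun j : {k : Fin n // E k i} => w.2 j.1)))
    (g := Prod.fst) (by fun_prop) (by fun_prop) measurable_fst
  have hprod : ∀ p q : Fin n → Prop, MeasurableSpace.comap
      (fun (z : (∀ i, 𝒳 i) × (∀ i, 𝒴 i)) => ((fun j : {k : Fin n // p k} => z.1 j.1),
        (fun j : {k : Fin n // q k} => z.2 j.1))) inferInstance =
      (⨆ j : {k : Fin n // p k}, mx j.1) ⊔ ⨆ j : {k : Fin n // q k}, my j.1 := fun p q =>
    (MeasurableSpace.comap_prodMk _ _).trans (congrArg₂ _ (hx p) (hy q))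
  have hcond : MeasurableSpace.comap
      (fun (z : (∀ i, 𝒳 i) × (∀ i, 𝒴 i)) => (z.1 i, (fun j : {k : Fin n // E k i} => z.1 j.1),
        (fun j : {k : Fin n // E k i} => z.2 j.1))) inferInstance =
      ((⨆ j : {k : Fin n // E k i}, mx j.1) ⊔ ⨆ j : {k : Fin n // E k i}, my j.1) ⊔ mx i :=
    (MeasurableSpace.comap_prodMk _ _).trans
      ((congrArg _ (hprod (E · i) (E · i))).trans (sup_comm _ _))
  have hpair : MeasurableSpace.comap
      (fun (z : (∀ i, 𝒳 i) × (∀ i, 𝒴 i)) => (z.1 i, z.2 i)) inferInstance = mx i ⊔ my i :=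
    MeasurableSpace.comap_prodMk _ _
  rw [hdist]
  simp only [condIndepRV_iff_sigma, hprod, hcond, hpair, hx, hxy, hle]
  rw [sup_right_comm]
  exact hcore

end Product

/-- Compatibility of the law of `V` with a DAG can be checked on `V` itself. -/
lemma isGComp_map_iff {n : ℕ} {E : Fin n → Fin n → Prop}
    {𝒵 : Fin n → Type} [∀ i, MeasurableSpace (𝒵 i)] {Ω : Type} {mΩ : MeasurableSpace Ω}
    {P : Measure Ω} [IsProbabilityMeasure P] {V : Ω → ∀ i, 𝒵 i} (hV : Measurable V) :
    IsGComp E 𝒵 (P.map V) ↔ ∀ i : Fin n,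
      CondIndepRV P (fun ω => V ω i)
        (fun ω (j : {k : Fin n // (k : ℕ) < (i : ℕ)}) => V ω j.1)
        (fun ω (j : {k : Fin n // E k i}) => V ω j.1) := by
  have htransfer : ∀ {Ω' : Type} {_ : MeasurableSpace Ω'} {P' : Measure Ω'}
      [IsProbabilityMeasure P'] {V' : Ω' → ∀ i, 𝒵 i} (_ : Measurable V') (i : Fin n),
      CondIndepRV (P'.map V') (fun v => v i)
        (fun v (j : {k : Fin n // (k : ℕ) < (i : ℕ)}) => v j.1)
        (fun v (j : {k : Fin n // E k i}) => v j.1) ↔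
      CondIndepRV P' (fun ω => V' ω i)
        (fun ω (j : {k : Fin n // (k : ℕ) < (i : ℕ)}) => V' ω j.1)
        (fun ω (j : {k : Fin n // E k i}) => V' ω j.1) := fun hV' i =>
    condIndepRV_map_iff hV' (by fun_prop) (by fun_prop) (by fun_prop)
  constructor
  · intro h i
    rcases Nat.eq_zero_or_pos i with hi | hi
    · rw [condIndepRV_iff_sigma]
      refine condIndepSigma_of_le (Measurable.comap_le (by fun_prop))
        (Measurable.comap_le (by fun_prop)) ?_
      rw [comap_pi_eq_iSup fun (j : {k : Fin n // (k : ℕ) < (i : ℕ)}) ω => V ω j.1]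
      exact iSup_le fun j => absurd j.2 (by lia)
    · exact h Ω mΩ P inferInstance V hV rfl i hi
  · intro h Ω' _ P' _ V' hV' hlaw i _
    rw [← htransfer hV', hlaw, htransfer hV]
    exact h i

/-- For a sorted DAG `G`, a `G`-compatible `μ`, a coupling `π` of `μ` and
`ν` and `(X, Y) ~ π`, condition (iii) is equivalent to condition (iv): `π` is jointly
`G`-compatible (as a measure on the product of the pairs `(𝒳 i × 𝒴 i)`) and
`π(dx_i | x_pa_i, y_pa_i) = μ(dx_i | x_pa_i)` for all `i` and `π`-almost all `(x, y)`. -/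
theorem condIndep_iii_iff_iv {n : ℕ} (E : Fin n → Fin n → Prop)
    (hE : ∀ i j, E i j → i < j) (𝒳 𝒴 : Fin n → Type)
    [∀ i, TopologicalSpace (𝒳 i)] [∀ i, PolishSpace (𝒳 i)]
    [∀ i, MeasurableSpace (𝒳 i)] [∀ i, BorelSpace (𝒳 i)] [∀ i, Nonempty (𝒳 i)]
    [∀ i, TopologicalSpace (𝒴 i)] [∀ i, PolishSpace (𝒴 i)]
    [∀ i, MeasurableSpace (𝒴 i)] [∀ i, BorelSpace (𝒴 i)] [∀ i, Nonempty (𝒴 i)]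
    (μ : Measure (∀ i, 𝒳 i)) (ν : Measure (∀ i, 𝒴 i))
    [IsProbabilityMeasure μ] [IsProbabilityMeasure ν]
    (hμ : IsGComp E 𝒳 μ)
    (π : Measure ((∀ i, 𝒳 i) × (∀ i, 𝒴 i))) [IsProbabilityMeasure π]
    (hπ : IsCoupling μ ν π)
    (Ω : Type) (mΩ : MeasurableSpace Ω) (P : Measure Ω) [IsProbabilityMeasure P]
    (X : Ω → ∀ i, 𝒳 i) (Y : Ω → ∀ i, 𝒴 i) (hX : Measurable X) (hY : Measurable Y)
    (hlaw : P.map (fun ω => (X ω, Y ω)) = π) :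
    (∀ i : Fin n,
      CondIndepRV P (fun ω => X ω i)
        (fun ω => ((fun j : {k : Fin n // (k : ℕ) < (i : ℕ)} => X ω j.1),
          (fun j : {k : Fin n // (k : ℕ) < (i : ℕ)} => Y ω j.1)))
        (fun ω (j : {k : Fin n // E k i}) => X ω j.1) ∧
      CondIndepRV P (fun ω => Y ω i)
        (fun ω => ((fun j : {k : Fin n // (k : ℕ) ≤ (i : ℕ)} => X ω j.1),
          (fun j : {k : Fin n // (k : ℕ) < (i : ℕ)} => Y ω j.1)))
        (fun ω => (X ω i, (fun j : {k : Fin n // E k i} => X ω j.1),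
          (fun j : {k : Fin n // E k i} => Y ω j.1))))
    ↔
    (IsGComp E (fun i => 𝒳 i × 𝒴 i) (π.map (fun z => fun i => (z.1 i, z.2 i))) ∧
      ∀ i : Fin n, ∀ᵐ z ∂π,
        condDistrib (fun w : (∀ l, 𝒳 l) × (∀ l, 𝒴 l) => w.1 i)
          (fun w => ((fun j : {k : Fin n // E k i} => w.1 j.1),
            (fun j : {k : Fin n // E k i} => w.2 j.1))) π
          ((fun j : {k : Fin n // E k i} => z.1 j.1),
            (fun j : {k : Fin n // E k i} => z.2 j.1))
        = condDistrib (fun x : ∀ l, 𝒳 l => x i)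
            (fun x (j : {k : Fin n // E k i}) => x j.1) μ
            (fun j : {k : Fin n // E k i} => z.1 j.1)) := by
  obtain ⟨rfl, -⟩ := hπ
  have hfst : ∀ p : Fin n → Prop, Measurable
      fun (z : (∀ i, 𝒳 i) × (∀ i, 𝒴 i)) (j : {k : Fin n // p k}) => z.1 j.1 := by fun_prop
  have hsnd : ∀ p : Fin n → Prop, Measurable
      fun (z : (∀ i, 𝒳 i) × (∀ i, 𝒴 i)) (j : {k : Fin n // p k}) => z.2 j.1 := by fun_prop
  have htransfer := fun i => and_congr
    (condIndepRV_map_iff (P := P) (hX.prodMk hY)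
      (S := fun z : (∀ i, 𝒳 i) × (∀ i, 𝒴 i) => z.1 i) (by fun_prop)
      ((hfst (fun k => (k : ℕ) < (i : ℕ))).prodMk (hsnd (fun k => (k : ℕ) < (i : ℕ))))
      (hfst (fun k => E k i)))
    (condIndepRV_map_iff (P := P) (hX.prodMk hY)
      (S := fun z : (∀ i, 𝒳 i) × (∀ i, 𝒴 i) => z.2 i) (by fun_prop)
      ((hfst (fun k => (k : ℕ) ≤ (i : ℕ))).prodMk (hsnd (fun k => (k : ℕ) < (i : ℕ))))
      (((measurable_pi_apply i).comp measurable_fst).prodMk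
        ((hfst (fun k => E k i)).prodMk (hsnd (fun k => E k i)))))
  rw [hlaw] at htransfer
  refine (forall_congr' fun i => (htransfer i).symm.trans (condIndepRV_and_iff π hE i)).trans ?_
  rw [forall_and]
  refine and_congr (isGComp_map_iff (𝒵 := fun i => 𝒳 i × 𝒴 i)
    (V := fun (z : (∀ i, 𝒳 i) × (∀ i, 𝒴 i)) i => (z.1 i, z.2 i)) (by fun_prop)).symm
    (forall_congr' fun i => Filter.eventually_congr ?_)
  have hmap := condDistrib_map (ν := π) (f := Prod.fst)
    (X := fun (x : ∀ l, 𝒳 l) (j : {k : Fin n // E k i}) => x j.1)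
    (Y := fun x : ∀ l, 𝒳 l => x i) (Measurable.aemeasurable (by fun_prop))
    (Measurable.aemeasurable (by fun_prop)) (by fun_prop)
  filter_upwards [ae_of_ae_map (hfst (fun k => E k i)).aemeasurable hmap] with z hz
  exact ⟨fun h => h.trans hz.symm, fun h => h.trans hz⟩
end
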